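/- arXiv:0912.3242 — 2 statements merged into one kernel-verified Lean document; each statement's English description precedes it below -/
import Mathlib

section
/- Let g be a finite-dimensional simple complex Lie algebra admitting a simple cuspidal weight module M (i.e. a simple weight module on which every root vector acts injectively). Then g is of type A_n or C_n. -/
namespace Paper

open scoped Classical

open Module

variable {L : Type*} [LieRing L] [LieAlgebra ℂ L]

/-- The weight space of a Lie module `M` for a functional `α` on the subalgebra `H`. -/
def wSpace (H : LieSubalgebra ℂ L) {M : Type*} [AddCommGroup M] [Module ℂ M]
    [LieRingModule L M] [LieModule ℂ L M] (α : Module.Dual ℂ H) : Submodule ℂ M where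
  carrier := {m | ∀ h : H, ⁅(h : L), m⁆ = α h • m}
  add_mem' := by
    intro x y hx hy h
    rw [lie_add, hx h, hy h, smul_add]
  zero_mem' := by intro h; rw [lie_zero, smul_zero]
  smul_mem' := by
    intro c x hx h
    rw [lie_smul, hx h, smul_comm]

/-- The root space `g^α`. -/
def gSpace (H : LieSubalgebra ℂ L) (α : Module.Dual ℂ H) : Submodule ℂ L :=
  wSpace H α

/-- `α` is a root of `(L, H)` : a nonzero functional with nonzero root space. -/
def IsRoot (H : LieSubalgebra ℂ L) (α : Module.Dual ℂ H) : Prop :=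
  α ≠ 0 ∧ gSpace H α ≠ ⊥

/-- `Δ` is a base (set of simple roots) of the root system of `(L, H)`: a linearly
independent set of roots such that every root is a linear combination of elements of `Δ`
with coefficients that are all nonnegative integers or all nonpositive integers. -/
def IsBase (H : LieSubalgebra ℂ L) (Δ : Finset (Module.Dual ℂ H)) : Prop :=
  (∀ β ∈ Δ, IsRoot H β) ∧
  LinearIndependent ℂ (fun β : Δ => (β : Module.Dual ℂ H)) ∧
  ∀ α, IsRoot H α →
    (∃ c : Module.Dual ℂ H → ℕ, α = ∑ β ∈ Δ, (c β : ℂ) • β) ∨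
    (∃ c : Module.Dual ℂ H → ℕ, α = -∑ β ∈ Δ, (c β : ℂ) • β)

/-- `α` is a positive root with respect to the base `Δ`. -/
def IsPos (H : LieSubalgebra ℂ L) (Δ : Finset (Module.Dual ℂ H))
    (α : Module.Dual ℂ H) : Prop :=
  IsRoot H α ∧ ∃ c : Module.Dual ℂ H → ℕ, α = ∑ β ∈ Δ, (c β : ℂ) • β

/-- `α ∈ ⟨θ⟩` : `α` is a root which is a (ℤ-)linear combination of elements of `θ`. -/
def InSpan (H : LieSubalgebra ℂ L) (θ : Finset (Module.Dual ℂ H))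
    (α : Module.Dual ℂ H) : Prop :=
  IsRoot H α ∧ ∃ c : Module.Dual ℂ H → ℤ, α = ∑ β ∈ θ, (c β : ℂ) • β

/-- The nilradical `n⁺_θ = ⨁_{α ∈ R⁺ \ ⟨θ⟩⁺} g^α` (as a subspace of `L`). -/
def nPlus (H : LieSubalgebra ℂ L) (Δ θ : Finset (Module.Dual ℂ H)) : Submodule ℂ L :=
  ⨆ α ∈ {α | IsPos H Δ α ∧ ¬ InSpan H θ α}, gSpace H α

/-- The standard Levi subalgebra `l_θ = h ⊕ ⨁_{α ∈ ⟨θ⟩} g^α` (as a subspace of `L`). -/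
def levi (H : LieSubalgebra ℂ L) (θ : Finset (Module.Dual ℂ H)) : Submodule ℂ L :=
  (H : Submodule ℂ L) ⊔ ⨆ α ∈ {α | InSpan H θ α}, gSpace H α

/-- The standard parabolic subalgebra `p_θ = l_θ ⊕ n⁺_θ` (as a subspace of `L`). -/
def par (H : LieSubalgebra ℂ L) (Δ θ : Finset (Module.Dual ℂ H)) : Submodule ℂ L :=
  levi H θ ⊔ nPlus H Δ θ

section Modules

variable (H : LieSubalgebra ℂ L) (M : Type*) [AddCommGroup M] [Module ℂ M]
  [LieRingModule L M] [LieModule ℂ L M]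

/-- `M` is a weight module: finitely generated, `h`-diagonalizable, with
finite-dimensional weight spaces. -/
def IsWeightModule : Prop :=
  (∃ s : Finset M, LieSubmodule.lieSpan ℂ L (s : Set M) = ⊤) ∧
  (⨆ α : Module.Dual ℂ H, wSpace H (M := M) α) = ⊤ ∧
  ∀ α : Module.Dual ℂ H, FiniteDimensional ℂ (wSpace H (M := M) α)

/-- The root `α` is locally nilpotent with respect to `M`. -/
def IsLocallyNilpotentRoot (α : Module.Dual ℂ H) : Prop :=
  ∀ x ∈ gSpace H α, ∀ m : M, ∃ n : ℕ, ((LieModule.toEnd ℂ L M x) ^ n) m = 0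

/-- The root `α` is cuspidal (injective) with respect to `M`. -/
def IsCuspidalRoot (α : Module.Dual ℂ H) : Prop :=
  ∀ x ∈ gSpace H α, x ≠ 0 → Function.Injective (LieModule.toEnd ℂ L M x)

end Modules


/-- `L` is a simple Lie algebra of type `A_n` for some `n`, i.e. isomorphic to `sl(n+1, ℂ)`. -/
def IsTypeA (L : Type*) [LieRing L] [LieAlgebra ℂ L] : Prop :=
  ∃ n : ℕ, Nonempty (L ≃ₗ⁅ℂ⁆ LieAlgebra.SpecialLinear.sl (Fin (n + 1)) ℂ)

/-- `L` is a simple Lie algebra of type `C_n` for some `n`, i.e. isomorphic to `sp(n, ℂ)`. -/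
def IsTypeC (L : Type*) [LieRing L] [LieAlgebra ℂ L] : Prop :=
  ∃ n : ℕ, Nonempty (L ≃ₗ⁅ℂ⁆ LieAlgebra.Symplectic.sp (Fin n) ℂ)


end Paper
namespace Paper
open Module

section SLpart
open LieAlgebra.SpecialLinear

theorem sl_coe_smul {n : ℕ} (c : ℂ) (x : sl (Fin (n+1)) ℂ) : (c • x).val = c • x.val := rfl

theorem sl_submodule_top {n : ℕ} (N : Submodule ℂ (sl (Fin (n+1)) ℂ))
    (h1 : ∀ (i j : Fin (n+1)) (h : i ≠ j), single i j h (1:ℂ) ∈ N)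
    (h2 : ∀ (i j : Fin (n+1)), i ≠ j → singleSubSingle i j (1:ℂ) ∈ N) : N = ⊤ := by
  rw [eq_top_iff]
  intro X _
  have h2' : ∀ i j : Fin (n+1), singleSubSingle i j (1:ℂ) ∈ N := by
    intro i j
    by_cases h : i = j
    · subst h
      have : singleSubSingle i i (1:ℂ) = 0 := by ext : 1; simp
      rw [this]; exact N.zero_mem
    · exact h2 i j h
  let F : Fin (n+1) → Fin (n+1) → sl (Fin (n+1)) ℂ := fun i j =>
    if h : i = j then singleSubSingle i 0 (1:ℂ) else single i j h (1:ℂ)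
  have hF : ∀ i j, F i j ∈ N := by
    intro i j
    by_cases h : i = j
    · simp only [F, h, dite_true]; exact h2' _ _
    · simp only [F, h, dite_false]; exact h1 _ _ _
  have hFv : ∀ i j, (F i j).val = Matrix.single i j (1:ℂ) - if i = j then Matrix.single 0 0 1 else 0 := by
    intro i j
    by_cases h : i = j
    · subst h; simp [F]
    · simp [F, h]
  obtain ⟨Y, hY⟩ : ∃ Y : Matrix (Fin (n+1)) (Fin (n+1)) ℂ, X.val = Y := ⟨_, rfl⟩
  have ht : ∑ i, Y i i = 0 := by rw [← hY]; exact X.2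
  have : X = ∑ i, ∑ j, Y i j • F i j := by
    apply Subtype.ext
    rw [AddSubmonoidClass.coe_finsetSum]
    simp_rw [AddSubmonoidClass.coe_finsetSum]
    simp only [sl_coe_smul, hFv, smul_sub, Finset.sum_sub_distrib]
    have e2 : ∀ Z : Matrix (Fin (n+1)) (Fin (n+1)) ℂ, ∑ i, ∑ j, Y i j • (if i = j then Z else 0) = 0 := by
      intro Z
      simp only [smul_ite, smul_zero, Finset.sum_ite_eq, Finset.mem_univ, if_true]
      rw [← Finset.sum_smul, ht, zero_smul]
    have main : Y = ∑ i, ∑ j, Y i j • Matrix.single i j (1:ℂ) -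
        ∑ i, ∑ j, Y i j • (if i = j then Matrix.single (0:Fin (n+1)) 0 (1:ℂ) else 0) := by
      refine Eq.trans ?_ (congrArg (fun z => _ - z) (e2 _).symm)
      rw [sub_zero]
      conv_lhs => rw [Matrix.matrix_eq_sum_single Y]
      simp
    exact hY.trans main
  rw [this]
  exact N.sum_mem fun i _ => N.sum_mem fun j _ => N.smul_mem _ (hF i j)

theorem sl_lie_single {n : ℕ} (i j k : Fin (n+1)) (hij : i ≠ j) (hjk : j ≠ k) (hik : i ≠ k) :
    ⁅single i j hij (1:ℂ), single j k hjk (1:ℂ)⁆ = single i k hik (1:ℂ) := by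
  apply Subtype.ext
  rw [sl_bracket]
  simp [hik.symm]

theorem sl_lie_single' {n : ℕ} (i j : Fin (n+1)) (hij : i ≠ j) :
    ⁅single i j hij (1:ℂ), single j i hij.symm (1:ℂ)⁆ = singleSubSingle i j (1:ℂ) := by
  apply Subtype.ext
  rw [sl_bracket]
  simp

theorem sl_dbl {n : ℕ} (i j : Fin (n+1)) (hij : i ≠ j) (X : sl (Fin (n+1)) ℂ) :
    ⁅single j i hij.symm (1:ℂ), ⁅single j i hij.symm (1:ℂ), X⁆⁆
      = (-2 * X.val i j) • single j i hij.symm (1:ℂ) := by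
  apply Subtype.ext
  rw [sl_bracket, sl_bracket]
  simp only [val_single, sl_coe_smul, mul_sub, sub_mul]
  have e : Matrix.single j i (1:ℂ) * (X.val * Matrix.single j i 1) = X.val i j • Matrix.single j i 1 := by
    rw [← mul_assoc, Matrix.single_mul_mul_single]; simp
  have e0 : Matrix.single j i (1:ℂ) * (Matrix.single j i 1) = 0 := by
    simp [hij]
  rw [mul_assoc (Matrix.single j i (1:ℂ)), e, mul_assoc X.val, e0, ← mul_assoc, e0]
  simp only [zero_mul, mul_zero]
  module

theorem sl_simple {n : ℕ} (hn : 1 ≤ n) : LieAlgebra.IsSimple ℂ (sl (Fin (n+1)) ℂ) where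
  non_abelian := sl_non_abelian _ _ (by simp; omega)
  eq_bot_or_eq_top I := by
    by_cases hI : I = ⊥
    · exact Or.inl hI
    right
    have hX : ∃ X ∈ I, X ≠ 0 := by
      by_contra hc
      push Not at hc
      exact hI ((LieSubmodule.eq_bot_iff I).2 hc)
    obtain ⟨X, hXI, hX0⟩ := hX
    have lr : ∀ (x y : sl (Fin (n+1)) ℂ), y ∈ I → ⁅x, y⁆ ∈ I := fun x y h => I.lie_mem h
    have ll : ∀ (x y : sl (Fin (n+1)) ℂ), x ∈ I → ⁅x, y⁆ ∈ I := fun x y h => by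
      rw [← lie_skew]; exact I.neg_mem (I.lie_mem h)
    have step1 : ∃ (i j : Fin (n+1)) (h : i ≠ j), single i j h (1:ℂ) ∈ I := by
      by_cases hd : ∃ i j, i ≠ j ∧ X.val i j ≠ 0
      · obtain ⟨i, j, hij, hx⟩ := hd
        refine ⟨j, i, hij.symm, ?_⟩
        have := lr (single j i hij.symm (1:ℂ)) _ (lr (single j i hij.symm (1:ℂ)) X hXI)
        rw [sl_dbl _ _ hij] at this
        exact (Submodule.smul_mem_iff I.toSubmodule (by simpa using hx)).1 this
      · push Not at hd
        have : ∃ i j, i ≠ j ∧ X.val i i ≠ X.val j j := by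
          by_contra hc
          push Not at hc
          have hc' : ∀ i, X.val i i = X.val 0 0 := by
            intro i
            by_cases h : i = 0
            · rw [h]
            · exact hc i 0 h
          have ht : ∑ i, X.val i i = 0 := X.2
          simp only [hc', Finset.sum_const, Finset.card_univ, Fintype.card_fin, nsmul_eq_mul] at ht
          have h0 : X.val 0 0 = 0 := by
            rcases mul_eq_zero.1 ht with h | h
            · exact absurd h (by exact_mod_cast Nat.succ_ne_zero n)
            · exact h
          apply hX0
          apply Subtype.ext
          ext i j
          by_cases h : i = j
          · subst h; rw [hc', h0]; rfl
          · rw [hd i j h]; rfl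
        obtain ⟨i, j, hij, hx⟩ := this
        refine ⟨i, j, hij, ?_⟩
        have := ll X (single i j hij (1:ℂ)) hXI
        have e : ⁅X, single i j hij (1:ℂ)⁆ = (X.val i i - X.val j j) • single i j hij (1:ℂ) := by
          apply Subtype.ext
          rw [sl_bracket]
          ext a b
          simp only [val_single, sl_coe_smul, Matrix.sub_apply, Matrix.smul_apply]
          have e1 : (X.val * Matrix.single i j (1:ℂ)) a b = if b = j then X.val a i else 0 := by
            split_ifs with h
            · subst h; simp
            · simp [h]
          have e2 : (Matrix.single i j (1:ℂ) * X.val) a b = if a = i then X.val j b else 0 := by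
            split_ifs with h
            · subst h; simp
            · simp [h]
          rw [e1, e2, Matrix.single_apply]
          have hd1 := hd a i
          have hd2 := hd j b
          by_cases ha : a = i <;> by_cases hb : b = j
          · subst ha hb; simp
          · subst ha; simp [hb, Ne.symm hb, hd2 (Ne.symm hb)]
          · subst hb; simp [ha, Ne.symm ha, hd1 ha]
          · simp [ha, hb, Ne.symm hb]
        rw [e] at this
        exact (Submodule.smul_mem_iff I.toSubmodule (sub_ne_zero.2 hx)).1 this
    obtain ⟨i, j, hij, hE⟩ := step1
    have row : ∀ (i j k : Fin (n+1)) (h : i ≠ j) (h' : i ≠ k), single i j h (1:ℂ) ∈ I → single i k h' (1:ℂ) ∈ I := by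
      intro i j k h h' hm
      by_cases hjk : j = k
      · subst hjk; exact hm
      · rw [← sl_lie_single i j k h hjk h']; exact ll _ _ hm
    have col : ∀ (i j k : Fin (n+1)) (h : i ≠ j) (h' : k ≠ j), single i j h (1:ℂ) ∈ I → single k j h' (1:ℂ) ∈ I := by
      intro i j k h h' hm
      by_cases hjk : k = i
      · subst hjk; exact hm
      · rw [← sl_lie_single k i j hjk h h']; exact lr _ _ hm
    have hji : single j i hij.symm (1:ℂ) ∈ I := by
      have := lr (single j i hij.symm (1:ℂ)) _ (lr (single j i hij.symm (1:ℂ)) _ hE)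
      rw [sl_dbl _ _ hij] at this
      exact (Submodule.smul_mem_iff I.toSubmodule (by simp)).1 this
    have all : ∀ (k l : Fin (n+1)) (h : k ≠ l), single k l h (1:ℂ) ∈ I := by
      intro k l h
      by_cases hk : k = j
      · subst hk
        exact row _ i _ _ _ hji
      · exact row k j l hk h (col i j k hij hk hE)
    have := sl_submodule_top I.toSubmodule all (fun i j h => by
      rw [← sl_lie_single' i j h]; exact ll _ _ (all _ _ _))
    exact (LieSubmodule.toSubmodule_eq_top _).1 this

/-- type A Cartan matrix -/
def cA (n : ℕ) : Matrix (Fin n) (Fin n) ℤ := fun i j =>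
  if i = j then 2 else if i.val + 1 = j.val ∨ j.val + 1 = i.val then -1 else 0

def slh {n : ℕ} (i : Fin n) : sl (Fin (n+1)) ℂ := singleSubSingle i.castSucc i.succ (1:ℂ)
def sle {n : ℕ} (i : Fin n) : sl (Fin (n+1)) ℂ := single i.castSucc i.succ (Fin.castSucc_lt_succ).ne (1:ℂ)
def slf {n : ℕ} (i : Fin n) : sl (Fin (n+1)) ℂ := single i.succ i.castSucc (Fin.castSucc_lt_succ).ne' (1:ℂ)

theorem sl_lie_h {n : ℕ} (d : Fin (n+1) → ℂ) (x y : sl (Fin (n+1)) ℂ)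
    (hx : x.val = Matrix.diagonal d) (a b : Fin (n+1)) (hy : y.val = Matrix.single a b (1:ℂ)) (c : ℤ)
    (hc : d a - d b = c) : ⁅x, y⁆ = c • y := by
  apply Subtype.ext
  rw [sl_bracket, hx, hy]
  rw [← Int.cast_smul_eq_zsmul ℂ c y, sl_coe_smul, hy, ← hc]
  ext k l
  simp only [Matrix.sub_apply, Matrix.diagonal_mul, Matrix.mul_diagonal, Matrix.smul_apply, Matrix.single_apply, smul_eq_mul]
  split_ifs with h
  · rw [← h.1, ← h.2]; ring
  · ring

theorem slh_val {n : ℕ} (i : Fin n) : (slh i).val = Matrix.diagonal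
    (fun k => (if k = i.castSucc then 1 else 0) - (if k = i.succ then (1:ℂ) else 0)) := by
  ext a b
  simp only [slh, val_singleSubSingle, Matrix.sub_apply, Matrix.single_apply, Matrix.diagonal_apply]
  by_cases h : a = b
  · subst h; simp [eq_comm]
  · have h1 : ∀ c, ¬ (c = a ∧ c = b) := fun c hc => h (hc.1.symm.trans hc.2)
    simp [h, h1]

def slBasis {n : ℕ} (hA : (cA n).Nondegenerate) :
    LieAlgebra.Basis (Fin n) (LieSubalgebra.lieSpan ℂ (sl (Fin (n+1)) ℂ) (Set.range slh)) where
  A := cA n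
  h := slh
  e := sle
  f := slf
  cartan_eq_lieSpan := rfl
  span_ef := by
    set S := LieSubalgebra.lieSpan ℂ (sl (Fin (n+1)) ℂ) (Set.range sle ∪ Set.range slf) with hS
    have he : ∀ i : Fin n, sle i ∈ S := fun i => LieSubalgebra.subset_lieSpan (Or.inl ⟨i, rfl⟩)
    have hf : ∀ i : Fin n, slf i ∈ S := fun i => LieSubalgebra.subset_lieSpan (Or.inr ⟨i, rfl⟩)
    have key : ∀ d : ℕ, ∀ (i j : Fin (n+1)) (h : i ≠ j), i.val + d + 1 = j.val →
        single i j h (1:ℂ) ∈ S ∧ single j i h.symm (1:ℂ) ∈ S := by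
      intro d
      induction d with
      | zero =>
        intro i j h hd
        have hi : i.val < n := by omega
        have e1 : i = (⟨i.val, hi⟩ : Fin n).castSucc := by ext; simp
        have e2 : j = (⟨i.val, hi⟩ : Fin n).succ := by ext; simp; omega
        constructor
        · have := he ⟨i.val, hi⟩; unfold sle at this; convert this
        · have := hf ⟨i.val, hi⟩; unfold slf at this; convert this
      | succ d ih =>
        intro i j h hd
        have hi : i.val < n := by omega
        let k : Fin (n+1) := (⟨i.val, hi⟩ : Fin n).succ
        have hk : k.val = i.val + 1 := by simp [k]
        have hik : i ≠ k := by intro h; have := congrArg Fin.val h; omega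
        have hkj : k ≠ j := by intro h; have := congrArg Fin.val h; omega
        have := ih k j hkj (by omega)
        constructor
        · rw [← sl_lie_single i k j hik hkj h]
          exact S.lie_mem (he ⟨i.val, hi⟩) this.1
        · rw [← sl_lie_single j k i hkj.symm hik.symm h.symm]
          exact S.lie_mem this.2 (hf ⟨i.val, hi⟩)
    have all : ∀ (k l : Fin (n+1)) (h : k ≠ l), single k l h (1:ℂ) ∈ S := by
      intro k l h
      have : k.val ≠ l.val := fun h' => h (Fin.ext h')
      rcases lt_or_gt_of_ne this with h1 | h1
      · exact (key (l.val - k.val - 1) k l h (by omega)).1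
      · exact (key (k.val - l.val - 1) l k h.symm (by omega)).2
    have := sl_submodule_top S.toSubmodule all (fun i j h => by
      rw [← sl_lie_single' i j h]; exact S.lie_mem (all _ _ _) (all _ _ _))
    exact LieSubalgebra.toSubmodule_injective this
  linInd := by
    rw [Fintype.linearIndependent_iff]
    intro g hg
    have hv : ∀ k : Fin (n+1), ∑ i, g i * ((if k = i.castSucc then 1 else 0) - (if k = i.succ then (1:ℂ) else 0)) = 0 := by
      intro k
      have := congrArg (fun x => x.val k k) hg
      simp only [AddSubmonoidClass.coe_finsetSum, sl_coe_smul, slh_val] at this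
      rw [Matrix.sum_apply] at this
      simpa using this
    have : ∀ m : ℕ, ∀ h : m < n, g ⟨m, h⟩ = 0 := by
      intro m
      induction m with
      | zero =>
        intro h
        have := hv (⟨0, h⟩ : Fin n).castSucc
        rw [Finset.sum_eq_single ⟨0, h⟩] at this
        · simpa [Fin.ext_iff] using this
        · intro b _ hb
          have : (0:ℕ) ≠ b.val := fun h => hb (Fin.ext h.symm)
          simp [Fin.ext_iff, this]
        · simp
      | succ m ih =>
        intro h
        have := hv (⟨m+1, h⟩ : Fin n).castSucc
        rw [Finset.sum_eq_single ⟨m+1, h⟩] at this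
        · simpa [Fin.ext_iff] using this
        · intro b _ hb
          have h1 : (m+1:ℕ) ≠ b.val := fun h => hb (Fin.ext h.symm)
          by_cases h2 : m = b.val
          · have : b = ⟨m, by omega⟩ := Fin.ext h2.symm
            rw [this, ih]; simp
          · simp [Fin.ext_iff, h1, h2]
        · simp
    intro i
    exact this i.val i.2
  nondegen := hA
  sl2 i := by
    refine ⟨?_, ?_, ?_, ?_⟩
    · intro h
      have := congrArg (fun x => x.val i.castSucc i.castSucc) h
      simp only [slh_val] at this
      simp [(Fin.castSucc_lt_succ (i := i)).ne] at this
    · exact sl_lie_single' _ _ _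
    · have := sl_lie_h _ _ (sle i) (slh_val i) _ _ rfl 2 (by simp [(Fin.castSucc_lt_succ (i := i)).ne,(Fin.castSucc_lt_succ (i := i)).ne']; norm_num)
      rw [this, ofNat_zsmul]
    · have := sl_lie_h _ _ (slf i) (slh_val i) _ _ rfl (-2) (by simp [(Fin.castSucc_lt_succ (i := i)).ne,(Fin.castSucc_lt_succ (i := i)).ne']; norm_num)
      rw [this, neg_zsmul, ofNat_zsmul]
  lie_h_h i j := by
    apply Subtype.ext
    rw [sl_bracket, slh_val, slh_val, Matrix.diagonal_mul_diagonal, Matrix.diagonal_mul_diagonal]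
    simp [mul_comm]
  lie_h_e i j := by
    refine sl_lie_h _ _ (sle i) (slh_val j) _ _ rfl _ ?_
    simp only [cA, Fin.ext_iff, Fin.val_castSucc, Fin.val_succ]
    split_ifs <;> first | omega | norm_num
  lie_h_f i j := by
    refine sl_lie_h _ _ (slf i) (slh_val j) _ _ rfl _ ?_
    simp only [cA, Fin.ext_iff, Fin.val_castSucc, Fin.val_succ]
    split_ifs <;> first | omega | norm_num
  lie_e_f_ne i j hij := by
    have h : i.val ≠ j.val := fun h => hij (Fin.ext h)
    apply Subtype.ext
    rw [sl_bracket]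
    have e1 : (i.castSucc = j.castSucc) = False := by simpa [Fin.ext_iff] using h
    have e2 : (i.succ = j.succ) = False := by simpa [Fin.ext_iff] using h
    have e3 : (j.castSucc = i.castSucc) = False := by simpa [Fin.ext_iff] using h.symm
    simp [sle, slf, hij, hij.symm]

end SLpart
end Paper
namespace Paper
open Module

section SPpart
open LieAlgebra.Symplectic Matrix

variable {m : ℕ}

abbrev SpI (m : ℕ) := Fin (m+1) ⊕ Fin (m+1)
abbrev Sp (m : ℕ) := sp (Fin (m+1)) ℂ

theorem sp_mem_iff (X : Matrix (SpI m) (SpI m) ℂ) :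
    X ∈ sp (Fin (m+1)) ℂ ↔ Xᵀ * J (Fin (m+1)) ℂ = J (Fin (m+1)) ℂ * (-X) := by
  unfold sp
  rw [mem_skewAdjointMatricesLieSubalgebra, mem_skewAdjointMatricesSubmodule]
  rfl

theorem sp_coe_smul (c : ℂ) (x : Sp m) : (c • x).val = c • x.val := rfl
theorem sp_coe_add (x y : Sp m) : (x + y).val = x.val + y.val := rfl
theorem sp_bracket (x y : Sp m) : ⁅x, y⁆.val = x.val * y.val - y.val * x.val := rfl

/-- rank two symmetric elements -/
def spE (u v : SpI m → ℂ) : Sp m :=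
  ⟨(vecMulVec u v + vecMulVec v u) * J (Fin (m+1)) ℂ, by
    rw [sp_mem_iff, transpose_mul, J_transpose]
    simp only [transpose_add, transpose_vecMulVec]
    rw [add_comm (vecMulVec v u)]
    simp [Matrix.mul_assoc]⟩

theorem spE_val (u v : SpI m → ℂ) : (spE u v).val = (vecMulVec u v + vecMulVec v u) * J (Fin (m+1)) ℂ := rfl

theorem spE_comm (u v : SpI m → ℂ) : spE u v = spE v u := by
  apply Subtype.ext; rw [spE_val, spE_val, add_comm (vecMulVec u v)]

theorem spE_add (u u' v : SpI m → ℂ) : spE (u + u') v = spE u v + spE u' v := by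
  apply Subtype.ext
  rw [sp_coe_add, spE_val, spE_val, spE_val, add_vecMulVec, vecMulVec_add, ← Matrix.add_mul]
  congr 1; abel

theorem spE_smul (c : ℂ) (u v : SpI m → ℂ) : spE (c • u) v = c • spE u v := by
  apply Subtype.ext
  rw [sp_coe_smul, spE_val, spE_val, smul_vecMulVec, vecMulVec_smul, ← smul_add, Matrix.smul_mul]

theorem spE_add' (u v v' : SpI m → ℂ) : spE u (v + v') = spE u v + spE u v' := by
  rw [spE_comm, spE_add, spE_comm v, spE_comm v']

theorem spE_smul' (c : ℂ) (u v : SpI m → ℂ) : spE u (c • v) = c • spE u v := by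
  rw [spE_comm, spE_smul, spE_comm v]

theorem sp_lie_spE (X : Sp m) (u v : SpI m → ℂ) :
    ⁅X, spE u v⁆ = spE (X.val *ᵥ u) v + spE u (X.val *ᵥ v) := by
  apply Subtype.ext
  rw [sp_bracket, sp_coe_add, spE_val, spE_val, spE_val]
  have h := (sp_mem_iff X.val).1 X.2
  have h' : J (Fin (m+1)) ℂ * X.val = - (X.valᵀ * J (Fin (m+1)) ℂ) := by
    rw [h]; simp
  rw [Matrix.mul_assoc _ (J _ _) X.val, h']
  simp only [Matrix.mul_neg, ← Matrix.mul_assoc, Matrix.mul_add, Matrix.add_mul, Matrix.mul_vecMulVec,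
    Matrix.vecMulVec_mul, Matrix.vecMul_transpose]
  abel

def om (u v : SpI m → ℂ) : ℂ := u ⬝ᵥ (J (Fin (m+1)) ℂ *ᵥ v)

theorem spE_mulVec (u v w : SpI m → ℂ) : (spE u v).val *ᵥ w = om v w • u + om u w • v := by
  rw [spE_val, ← Matrix.mulVec_mulVec, Matrix.add_mulVec, Matrix.vecMulVec_mulVec, Matrix.vecMulVec_mulVec]
  simp [om]

/-- basis elements -/
def spw (a b : SpI m) : Sp m := spE (Pi.single a 1) (Pi.single b 1)

theorem spw_comm (a b : SpI m) : spw a b = spw b a := spE_comm _ _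

def omi : SpI m → SpI m → ℂ
  | .inl i, .inr j => if i = j then -1 else 0
  | .inr i, .inl j => if i = j then 1 else 0
  | _, _ => 0

theorem om_single (a b : SpI m) : om (Pi.single a 1) (Pi.single b 1) = omi a b := by
  unfold om
  rw [Matrix.mulVec_single_one, single_one_dotProduct]
  rcases a with a | a <;> rcases b with b | b <;> simp [J, omi, Matrix.one_apply]
  split_ifs <;> simp

theorem spw_lie (a b c d : SpI m) : ⁅spw a b, spw c d⁆ =
    omi b c • spw a d + omi a c • spw b d + (omi b d • spw c a + omi a d • spw c b) := by
  unfold spw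
  rw [sp_lie_spE, spE_mulVec, spE_mulVec]
  simp only [spE_add, spE_add', spE_smul, spE_smul', om_single]

theorem sp_eq_sum (X : Sp m) : ∃ c : SpI m → SpI m → ℂ, X = ∑ a, ∑ b, c a b • spw a b := by
  have h := (sp_mem_iff X.val).1 X.2
  let Y : Matrix (SpI m) (SpI m) ℂ := - (X.val * J (Fin (m+1)) ℂ)
  have hYX : Y * J (Fin (m+1)) ℂ = X.val := by
    simp only [Y, Matrix.neg_mul, Matrix.mul_assoc, J_squared]; simp
  have hY : Yᵀ = Y := by
    simp only [Y, transpose_neg, transpose_mul, J_transpose]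
    have h2 := congrArg (fun Z => J (Fin (m+1)) ℂ * Z * J (Fin (m+1)) ℂ) h
    simp only [Matrix.mul_assoc, J_squared] at h2
    rw [← Matrix.mul_assoc (J _ _) (J _ _), J_squared] at h2
    simp at h2
    simp [← h2]
  refine ⟨fun a b => (1/2) * Y a b, ?_⟩
  apply Subtype.ext
  rw [AddSubmonoidClass.coe_finsetSum]
  simp_rw [AddSubmonoidClass.coe_finsetSum]
  have hw : ∀ a b : SpI m, (spw a b).val = (Matrix.single a b 1 + Matrix.single b a 1) * J (Fin (m+1)) ℂ := by
    intro a b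
    rw [spw, spE_val, Matrix.single_eq_single_vecMulVec_single, Matrix.single_eq_single_vecMulVec_single]
  have key : Y = ∑ a, ∑ b, ((1/2) * Y a b) • (Matrix.single a b (1:ℂ) + Matrix.single b a 1) := by
    have e1 : ∑ a, ∑ b, ((1/2) * Y a b) • Matrix.single a b (1:ℂ) = (1/2 : ℂ) • Y := by
      conv_rhs => rw [Matrix.matrix_eq_sum_single Y]
      simp [Finset.smul_sum]
    have e2 : ∑ a, ∑ b, ((1/2) * Y a b) • Matrix.single b a (1:ℂ) = (1/2 : ℂ) • Y := by
      rw [Finset.sum_comm]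
      rw [← e1]
      refine Finset.sum_congr rfl fun a _ => Finset.sum_congr rfl fun b _ => ?_
      have : Y b a = Y a b := congrFun (congrFun hY a) b
      rw [this]
    simp only [smul_add, Finset.sum_add_distrib]
    refine Eq.trans ?_ (congrArg₂ (· + ·) e1 e2).symm
    module
  have key2 : X.val = ∑ a, ∑ b, ((1/2) * Y a b) • (spw a b).val := by
    rw [← hYX]
    conv_lhs => rw [key]
    simp only [hw, Matrix.sum_mul, Matrix.smul_mul]
  exact key2

theorem sp_submodule_top (N : Submodule ℂ (Sp m)) (h : ∀ a b, spw a b ∈ N) : N = ⊤ := by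
  rw [eq_top_iff]
  intro X _
  obtain ⟨c, hc⟩ := sp_eq_sum X
  rw [hc]
  exact N.sum_mem fun i _ => N.sum_mem fun j _ => N.smul_mem _ (h i j)

theorem spE_dbl (v : SpI m → ℂ) (X : Sp m) :
    ⁅spE v v, ⁅spE v v, X⁆⁆ = (-4 * om v (X.val *ᵥ v)) • spE v v := by
  have hvv : om v v = 0 := by
    unfold om
    have : v ⬝ᵥ (J (Fin (m+1)) ℂ *ᵥ v) = - (v ⬝ᵥ (J (Fin (m+1)) ℂ *ᵥ v)) := by
      conv_lhs => rw [Matrix.dotProduct_mulVec, ← Matrix.mulVec_transpose, J_transpose, dotProduct_comm]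
      simp [Matrix.neg_mulVec]
    exact self_eq_neg.1 this
  rw [← lie_skew (spE v v) X, sp_lie_spE, lie_neg, lie_add, sp_lie_spE, sp_lie_spE, spE_mulVec, spE_mulVec, hvv]
  simp only [zero_smul, add_zero, spE_add, spE_add', spE_smul, spE_smul', spE_comm]
  have : spE (0 : SpI m → ℂ) (X.val *ᵥ v) = 0 := by
    have := spE_smul (0:ℂ) v (X.val *ᵥ v); simpa using this
  have h2 : spE (X.val *ᵥ v) (0 : SpI m → ℂ) = 0 := by
    rw [spE_comm]; exact this
  rw [h2]
  module

theorem sp_simple : LieAlgebra.IsSimple ℂ (Sp m) where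
  non_abelian := by
    intro h
    have h1 : ⁅spw (m := m) (.inl 0) (.inr 0), spw (.inl 0) (.inl 0)⁆ = 0 := h.trivial _ _
    rw [spw_lie] at h1
    have h2 := congrArg (fun x => x.val (.inl 0) (.inr 0)) h1
    simp [omi, sp_coe_add] at h2
    simp [spw, spE_val, J, Matrix.mul_apply, vecMulVec_apply, Pi.single_apply, Matrix.one_apply] at h2
  eq_bot_or_eq_top I := by
    by_cases hI : I = ⊥
    · exact Or.inl hI
    right
    have hX : ∃ X ∈ I, X ≠ 0 := by
      by_contra hc
      push Not at hc
      exact hI ((LieSubmodule.eq_bot_iff I).2 hc)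
    obtain ⟨X, hXI, hX0⟩ := hX
    have lr : ∀ (x y : Sp m), y ∈ I → ⁅x, y⁆ ∈ I := fun x y h => I.lie_mem h
    have step1 : ∃ v, v ≠ 0 ∧ spE v v ∈ I := by
      have : ∃ v, om v (X.val *ᵥ v) ≠ 0 := by
        by_contra hc
        push Not at hc
        apply hX0
        have hpol : ∀ a b, om (Pi.single a 1) (X.val *ᵥ (Pi.single b 1)) + om (Pi.single b 1) (X.val *ᵥ (Pi.single a 1)) = 0 := by
          intro a b
          have h1 := hc (Pi.single a 1 + Pi.single b 1)
          have h2 := hc (Pi.single a 1)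
          have h3 := hc (Pi.single b 1)
          simp only [om, Matrix.mulVec_add, add_dotProduct, dotProduct_add] at h1 h2 h3 ⊢
          linear_combination h1 - h2 - h3
        set K : Matrix (SpI m) (SpI m) ℂ := J (Fin (m+1)) ℂ * X.val with hK
        have hent : ∀ a b, om (Pi.single a 1) (X.val *ᵥ (Pi.single b 1)) = K a b := by
          intro a b
          rw [om, Matrix.mulVec_mulVec, Matrix.mulVec_single_one, single_one_dotProduct]; rfl
        have hsym : Kᵀ = K := by
          rw [hK, transpose_mul, J_transpose]
          have h := (sp_mem_iff X.val).1 X.2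
          rw [Matrix.mul_neg, h]; simp
        have hK0 : K = 0 := by
          ext a b
          have h1 := hpol a b
          rw [hent, hent] at h1
          have h2 : K b a = K a b := congrFun (congrFun hsym a) b
          rw [h2] at h1
          simpa using h1
        apply Subtype.ext
        have : X.val = - (J (Fin (m+1)) ℂ * K) := by
          rw [hK, ← Matrix.mul_assoc, J_squared]; simp
        rw [this, hK0]; simp
      obtain ⟨v, hv⟩ := this
      refine ⟨v, ?_, ?_⟩
      · rintro rfl; simp [om] at hv
      · have := lr (spE v v) _ (lr (spE v v) X hXI)
        rw [spE_dbl] at this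
        exact (Submodule.smul_mem_iff I.toSubmodule (by simpa using hv)).1 this
    obtain ⟨v, hv0, hv⟩ := step1
    have trans : ∀ u, ∃ Z : Sp m, Z.val *ᵥ v = u := by
      intro u
      have : ∃ w, om w v = 1 := by
        have hJv : J (Fin (m+1)) ℂ *ᵥ v ≠ 0 := by
          intro h
          have := congrArg (fun z => J (Fin (m+1)) ℂ *ᵥ z) h
          simp [Matrix.mulVec_mulVec, J_squared, Matrix.neg_mulVec] at this
          exact hv0 this
        obtain ⟨a, ha⟩ := Function.ne_iff.1 hJv
        refine ⟨Pi.single a ((J (Fin (m+1)) ℂ *ᵥ v) a)⁻¹, ?_⟩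
        rw [om, single_dotProduct]
        exact inv_mul_cancel₀ ha
      obtain ⟨w, hw⟩ := this
      refine ⟨spE u w - (om u v / 2) • spE w w, ?_⟩
      have : (spE u w - (om u v / 2) • spE w w).val = (spE u w).val - (om u v / 2) • (spE w w).val := rfl
      rw [this, Matrix.sub_mulVec, Matrix.smul_mulVec, spE_mulVec, spE_mulVec, hw]
      module
    have h1 : ∀ u, spE u v ∈ I := by
      intro u
      obtain ⟨Z, hZ⟩ := trans u
      have := lr Z _ hv
      rw [sp_lie_spE, hZ, spE_comm v u, ← two_smul ℂ] at this
      exact (Submodule.smul_mem_iff I.toSubmodule (by simp)).1 this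
    have h2 : ∀ u w, spE u w ∈ I := by
      intro u w
      obtain ⟨Z, hZ⟩ := trans w
      have := lr Z _ (h1 u)
      rw [sp_lie_spE, hZ] at this
      exact (Submodule.add_mem_iff_right I.toSubmodule (h1 _)).1 this
    exact (LieSubmodule.toSubmodule_eq_top _).1 (sp_submodule_top I.toSubmodule fun a b => h2 _ _)

/-- type C Cartan matrix, with the long root first -/
def cC (n : ℕ) : Matrix (Fin n) (Fin n) ℤ := fun i j =>
  if i = j then 2 else if i.val + 1 = j.val ∨ j.val + 1 = i.val then (if i.val = 0 then -2 else -1)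
    else 0

def spd (i k : Fin (m+1)) : ℂ := (if k = i then 1 else 0) - (if k.val + 1 = i.val then 1 else 0)

def spHd (d : Fin (m+1) → ℂ) : Sp m := ∑ k, d k • spw (.inl k) (.inr k)

theorem spHd_ll (d : Fin (m+1) → ℂ) (i j : Fin (m+1)) :
    ⁅spHd d, spw (.inl i) (.inl j)⁆ = (d i + d j) • spw (.inl i) (.inl j) := by
  simp only [spHd, sum_lie, smul_lie, spw_lie]
  simp [omi, Finset.sum_add_distrib, add_smul]

theorem spHd_rr (d : Fin (m+1) → ℂ) (i j : Fin (m+1)) :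
    ⁅spHd d, spw (.inr i) (.inr j)⁆ = (- d i - d j) • spw (.inr i) (.inr j) := by
  simp only [spHd, sum_lie, smul_lie, spw_lie]
  simp [omi, Finset.sum_add_distrib, add_smul, sub_smul]
  abel

theorem spHd_lr (d : Fin (m+1) → ℂ) (i j : Fin (m+1)) :
    ⁅spHd d, spw (.inl i) (.inr j)⁆ = (d i - d j) • spw (.inl i) (.inr j) := by
  simp only [spHd, sum_lie, smul_lie, spw_lie]
  simp [omi, Finset.sum_add_distrib, sub_smul]
  abel

theorem spHd_inj (d : Fin (m+1) → ℂ) (h : spHd d = 0) (k : Fin (m+1)) : d k = 0 := by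
  have h1 := spHd_ll d k k
  rw [h, zero_lie] at h1
  have h0 : spw (m := m) (.inl k) (.inl k) ≠ 0 := by
    intro h
    have h2 := congrArg (fun x => x.val (.inl k) (.inr k)) h
    simp [spw, spE_val, J, Matrix.mul_apply, vecMulVec_apply, Pi.single_apply, Matrix.one_apply] at h2
  rcases smul_eq_zero.1 h1.symm with h2 | h2
  · linear_combination h2 / 2
  · exact absurd h2 h0

def sph (i : Fin (m+1)) : Sp m := spHd (spd i)
noncomputable def spe : Fin (m+1) → Sp m :=
  Fin.cases ((-1/2 : ℂ) • spw (.inl 0) (.inl 0)) (fun j => spw (.inl j.succ) (.inr j.castSucc))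
noncomputable def spf : Fin (m+1) → Sp m :=
  Fin.cases ((1/2 : ℂ) • spw (.inr 0) (.inr 0)) (fun j => spw (.inl j.castSucc) (.inr j.succ))

theorem spe_zero : spe (m := m) 0 = (-1/2 : ℂ) • spw (.inl 0) (.inl 0) := rfl
theorem spf_zero : spf (m := m) 0 = (1/2 : ℂ) • spw (.inr 0) (.inr 0) := rfl
theorem spe_succ (j : Fin m) : spe j.succ = spw (.inl j.succ) (.inr j.castSucc) := rfl
theorem spf_succ (j : Fin m) : spf j.succ = spw (.inl j.castSucc) (.inr j.succ) := rfl

theorem sp_gen_aux {V : Type*} [AddCommGroup V] [Module ℂ V] (N : Submodule ℂ V)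
    (F : Fin (m+1) → Fin (m+1) → V) (hs : ∀ i j, F i j = F j i) (h0 : F 0 0 ∈ N)
    (hc : ∀ (k : Fin m) (i j : Fin (m+1)), F i j ∈ N →
      (if i = k.castSucc then F k.succ j else 0) + (if j = k.castSucc then F i k.succ else 0) ∈ N) :
    ∀ i j, F i j ∈ N := by
  have hi0 : ∀ i, F i 0 ∈ N := by
    intro i
    induction i using Fin.induction with
    | zero => exact h0
    | succ k ih =>
      have := hc k _ _ ih
      rw [if_pos rfl] at this
      split_ifs at this with h
      · rw [hs k.castSucc, ← h, ← two_smul ℂ] at this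
        exact (Submodule.smul_mem_iff N (by simp)).1 this
      · simpa using this
  intro i j
  revert i
  induction j using Fin.induction with
  | zero => exact hi0
  | succ k ih =>
    intro i
    have := hc k _ _ (ih i)
    simp only [if_true] at this
    refine (Submodule.add_mem_iff_right N ?_).1 this
    split_ifs
    · exact ih _
    · exact N.zero_mem

theorem sp_gen (S : LieSubalgebra ℂ (Sp m)) (he : ∀ i, spe i ∈ S) (hf : ∀ i, spf i ∈ S) : S = ⊤ := by
  have hll : ∀ i j, spw (.inl i) (.inl j) ∈ S.toSubmodule := by
    refine sp_gen_aux S.toSubmodule (fun i j => spw (.inl i) (.inl j)) (fun i j => spw_comm _ _) ?_ ?_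
    · have := he 0
      rw [spe_zero] at this
      exact (Submodule.smul_mem_iff S.toSubmodule (by norm_num)).1 this
    · intro k i j h
      have := S.lie_mem (he k.succ) h
      rw [spe_succ, spw_lie] at this
      simp only [omi, zero_smul, ite_smul, one_smul, add_zero] at this
      simp only [eq_comm (a := k.castSucc)] at this
      exact this
  have hrr : ∀ i j, spw (.inr i) (.inr j) ∈ S.toSubmodule := by
    refine sp_gen_aux S.toSubmodule (fun i j => spw (.inr i) (.inr j)) (fun i j => spw_comm _ _) ?_ ?_
    · have := hf 0
      rw [spf_zero] at this
      exact (Submodule.smul_mem_iff S.toSubmodule (by norm_num)).1 this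
    · intro k i j h
      have := S.neg_mem (S.lie_mem (hf k.succ) h)
      rw [spf_succ, spw_lie] at this
      simp only [omi, zero_smul, ite_smul, neg_smul, one_smul, zero_add] at this
      rw [neg_add] at this
      convert this using 2
      · by_cases h : k.castSucc = i
        · rw [if_pos h, if_pos h.symm, neg_neg]
        · rw [if_neg h, if_neg (Ne.symm h), neg_zero]
      · by_cases h : k.castSucc = j
        · rw [if_pos h, if_pos h.symm, neg_neg]
        · rw [if_neg h, if_neg (Ne.symm h), neg_zero]
  have hlr : ∀ i j, spw (.inl i) (.inr j) ∈ S.toSubmodule := by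
    intro i j
    have := S.lie_mem (hll i i) (hrr i j)
    rw [spw_lie] at this
    simp only [omi, if_true] at this
    by_cases h : i = j
    · subst h
      simp only [if_true, spw_comm (.inr i) (.inl i)] at this
      rw [← add_smul, ← add_smul] at this
      exact (Submodule.smul_mem_iff S.toSubmodule (by norm_num)).1 this
    · simp only [h, if_false] at this
      simp only [zero_smul] at this
      rw [add_zero, add_zero, ← add_smul] at this
      exact (Submodule.smul_mem_iff S.toSubmodule (by norm_num)).1 this
  refine LieSubalgebra.toSubmodule_injective (sp_submodule_top S.toSubmodule ?_)
  rintro (i | i) (j | j)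
  · exact hll _ _
  · exact hlr _ _
  · rw [spw_comm]; exact hlr _ _
  · exact hrr _ _

theorem sp_lie_he (i j : Fin (m+1)) : ⁅sph j, spe i⁆ = cC (m+1) i j • spe i := by
  rw [← Int.cast_smul_eq_zsmul ℂ]
  unfold sph
  induction i using Fin.cases with
  | zero =>
    rw [spe_zero, lie_smul, spHd_ll, smul_comm]
    congr 1
    simp only [spd, cC, Fin.ext_iff, Fin.val_zero, if_true]
    obtain ⟨j, hj⟩ := j
    rcases j with _ | _ | j <;> norm_num
  | succ i =>
    rw [spe_succ, spHd_lr]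
    congr 1
    simp only [spd, cC, Fin.ext_iff, Fin.val_castSucc, Fin.val_succ]
    split_ifs <;> first | omega | (exfalso; omega) | norm_num

theorem sp_lie_hf (i j : Fin (m+1)) : ⁅sph j, spf i⁆ = -cC (m+1) i j • spf i := by
  rw [← Int.cast_smul_eq_zsmul ℂ]
  unfold sph
  induction i using Fin.cases with
  | zero =>
    rw [spf_zero, lie_smul, spHd_rr, smul_comm]
    congr 1
    simp only [spd, cC, Fin.ext_iff, Fin.val_zero, if_true]
    obtain ⟨j, hj⟩ := j
    rcases j with _ | _ | j <;> norm_num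
  | succ i =>
    rw [spf_succ, spHd_lr]
    congr 1
    simp only [spd, cC, Fin.ext_iff, Fin.val_castSucc, Fin.val_succ]
    split_ifs <;> first | omega | (exfalso; omega) | norm_num

theorem sp_ef (i : Fin (m+1)) : ⁅spe i, spf i⁆ = sph i := by
  unfold sph spHd
  induction i using Fin.cases with
  | zero =>
    rw [spe_zero, spf_zero, smul_lie, lie_smul, spw_lie, Finset.sum_eq_single 0]
    · simp only [omi, spd, if_true]
      rw [spw_comm (.inr 0)]
      simp only [Fin.val_zero]
      norm_num
      module
    · intro b _ hb
      simp [spd, hb]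
    · simp
  | succ i =>
    rw [spe_succ, spf_succ, spw_lie]
    have : ∀ k, spd i.succ k • spw (.inl k) (.inr k) = (if k = i.succ then spw (.inl k) (.inr k) else 0) -
       (if k = i.castSucc then spw (.inl k) (.inr k) else 0) := by
      intro k
      simp only [spd, Fin.ext_iff, Fin.val_succ, Fin.val_castSucc, Nat.add_right_cancel_iff]
      split_ifs <;> simp
    simp only [this, Finset.sum_sub_distrib, Finset.sum_ite_eq', Finset.mem_univ, if_true]
    simp [omi]
    abel

noncomputable def spBasis (hA : (cC (m+1)).Nondegenerate) :
    LieAlgebra.Basis (Fin (m+1)) (LieSubalgebra.lieSpan ℂ (Sp m) (Set.range sph)) where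
  A := cC (m+1)
  h := sph
  e := spe
  f := spf
  cartan_eq_lieSpan := rfl
  span_ef := sp_gen _ (fun i => LieSubalgebra.subset_lieSpan (Or.inl ⟨i, rfl⟩))
    (fun i => LieSubalgebra.subset_lieSpan (Or.inr ⟨i, rfl⟩))
  linInd := by
    rw [Fintype.linearIndependent_iff]
    intro g hg
    have h1 : ∑ i, g i • sph (m := m) i = spHd (fun k => ∑ i, g i * spd i k) := by
      simp only [sph, spHd, Finset.smul_sum, smul_smul, Finset.sum_smul]
      rw [Finset.sum_comm]
    rw [h1] at hg
    have h2 := spHd_inj _ hg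
    intro i
    have h3 : ∀ k : Fin (m+1), g k = if h : k.val + 1 < m + 1 then g ⟨k.val+1, h⟩ else 0 := by
      intro k
      have := h2 k
      simp only [spd, mul_sub, mul_ite, mul_one, mul_zero, Finset.sum_sub_distrib, Finset.sum_ite_eq,
        Finset.mem_univ, if_true] at this
      rw [sub_eq_zero] at this
      rw [this]
      split_ifs with h
      · rw [Finset.sum_eq_single ⟨k.val+1, h⟩]
        · simp
        · intro b _ hb
          rw [if_neg]
          intro h'
          exact hb (Fin.ext h'.symm)
        · simp
      · apply Finset.sum_eq_zero
        intro b _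
        rw [if_neg]
        have := b.2
        omega
    have h4 : ∀ d : ℕ, ∀ k : Fin (m+1), k.val + d = m → g k = 0 := by
      intro d
      induction d with
      | zero => intro k hk; rw [h3, dif_neg (by omega)]
      | succ d ih => intro k hk; rw [h3, dif_pos (by omega)]; exact ih _ (by simp; omega)
    exact h4 (m - i.val) i (by omega)
  nondegen := hA
  sl2 i := by
    have hd : cC (m+1) i i = 2 := by simp [cC]
    refine ⟨?_, sp_ef i, ?_, ?_⟩
    · intro h
      have := spHd_inj _ h i
      simp [spd] at this
    · rw [sp_lie_he, hd, ofNat_zsmul]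
    · rw [sp_lie_hf, hd, neg_zsmul, ofNat_zsmul]
  lie_h_h i j := by
    conv_lhs => unfold sph; rw [spHd.eq_def (spd j)]
    rw [lie_sum]
    apply Finset.sum_eq_zero
    intro k _
    rw [lie_smul, spHd_lr, sub_self, zero_smul, smul_zero]
  lie_h_e := sp_lie_he
  lie_h_f := sp_lie_hf
  lie_e_f_ne i j hij := by
    induction i using Fin.cases with
    | zero =>
      induction j using Fin.cases with
      | zero => exact absurd rfl hij
      | succ j =>
        rw [spe_zero, spf_succ, smul_lie, spw_lie]
        simp [omi, (Fin.succ_ne_zero j).symm]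
    | succ i =>
      induction j using Fin.cases with
      | zero =>
        rw [spf_zero, spe_succ, lie_smul, spw_lie]
        simp [omi, (Fin.succ_ne_zero i)]
      | succ j =>
        have : i ≠ j := fun h => hij (by rw [h])
        rw [spf_succ, spe_succ, spw_lie]
        simp [omi, this]

end SPpart
end Paper
namespace Paper
open Module

section P3part
open LieAlgebra LieAlgebra.IsKilling LieModule

variable {L : Type*} [LieRing L] [LieAlgebra ℂ L] [FiniteDimensional ℂ L] [LieAlgebra.IsKilling ℂ L]
  {H : LieSubalgebra ℂ L} [H.IsCartanSubalgebra]

lemma prop_of_mem {α : Weight ℂ H L} (hα : α.IsNonZero) {x y : L}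
    (hx : x ∈ rootSpace H α) (hx0 : x ≠ 0) (hy : y ∈ rootSpace H α) : ∃ c : ℂ, y = c • x := by
  have h1 := finrank_rootSpace_eq_one α hα
  have := (finrank_eq_one_iff_of_nonzero' (⟨x, hx⟩ : rootSpace H α)
    (by simpa [Subtype.ext_iff] using hx0)).1 h1 ⟨y, hy⟩
  obtain ⟨c, hc⟩ := this
  exact ⟨c, by simpa using (congrArg Subtype.val hc).symm⟩

lemma lie_ne_zero_of_add {α β γ : Weight ℂ H L} (hα : α.IsNonZero) (hβ : β.IsNonZero)
    (hγ : (γ : H → ℂ) = α + β) {x y : L}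
    (hx : x ∈ rootSpace H α) (hx0 : x ≠ 0) (hy : y ∈ rootSpace H β) (hy0 : y ≠ 0) :
    ⁅x, y⁆ ≠ 0 := by
  obtain ⟨t, ht, ht0⟩ := (chainTop α β).exists_ne_zero
  obtain ⟨h, e, f, isSl2, he, hf⟩ := exists_isSl2Triple_of_weight_isNonZero hα
  obtain rfl := isSl2.h_eq_coroot hα he hf
  have prim : isSl2.HasPrimitiveVectorWith t (chainLength α β : ℂ) :=
    have := lie_mem_genWeightSpace_of_mem_genWeightSpace he ht
    ⟨ht0, (chainLength_smul _ _ ht).symm, by rwa [genWeightSpace_add_chainTop _ _ hα] at this⟩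
  have hk : 1 ≤ chainTopCoeff α β := by
    have := (rootSpace_zsmul_add_ne_bot_iff (H := H) α β hα 1).1 (by
      have := γ.2; rw [one_smul, ← hγ]; exact this)
    exact_mod_cast this.1
  obtain ⟨n, hn⟩ : ∃ n, chainTopCoeff α β = n + 1 := ⟨chainTopCoeff α β - 1, by omega⟩
  have hle := chainTopCoeff_le_chainLength α β
  rw [hn] at hle
  have hm : ((toEnd ℂ L L f) ^ (n+1)) t ∈ rootSpace H β := by
    have := toEnd_pow_apply_mem hf ht (n+1)
    have e1 : (n+1) • (-α : H → ℂ) + chainTop α β = β := by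
      rw [coe_chainTop', hn, smul_neg, neg_add_cancel_left]
    rw [e1] at this
    exact this
  obtain ⟨c, hc⟩ := prop_of_mem hα he isSl2.e_ne_zero hx
  obtain ⟨d, hd⟩ := prop_of_mem hβ hm (prim.pow_toEnd_f_ne_zero_of_eq_nat rfl hle) hy
  have hc0 : c ≠ 0 := by rintro rfl; simp at hc; exact hx0 hc
  have hd0 : d ≠ 0 := by rintro rfl; simp at hd; exact hy0 hd
  rw [hc, hd, smul_lie, lie_smul, prim.lie_e_pow_succ_toEnd_f]
  refine smul_ne_zero hc0 (smul_ne_zero hd0 (smul_ne_zero (mul_ne_zero ?_ ?_)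
    (prim.pow_toEnd_f_ne_zero_of_eq_nat rfl (by omega))))
  · exact_mod_cast Nat.succ_ne_zero n
  · rw [sub_ne_zero]; exact_mod_cast (by omega)

lemma rootSpace_le_of_add {S : LieSubalgebra ℂ L} {α β γ : Weight ℂ H L} (hα : α.IsNonZero)
    (hβ : β.IsNonZero) (hγ0 : γ.IsNonZero) (hγ : (γ : H → ℂ) = α + β)
    (hS : ∀ x ∈ rootSpace H α, x ∈ S) (hS' : ∀ x ∈ rootSpace H β, x ∈ S) :
    ∀ x ∈ rootSpace H γ, x ∈ S := by
  obtain ⟨x, hx, hx0⟩ := α.exists_ne_zero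
  obtain ⟨y, hy, hy0⟩ := β.exists_ne_zero
  intro z hz
  have h1 := lie_ne_zero_of_add hα hβ hγ hx hx0 hy hy0
  have h2 : ⁅x, y⁆ ∈ rootSpace H γ := by
    rw [hγ]; exact lie_mem_genWeightSpace_of_mem_genWeightSpace hx hy
  obtain ⟨c, rfl⟩ := prop_of_mem hγ0 h2 h1 hz
  exact S.smul_mem _ (S.lie_mem (hS x hx) (hS' y hy))

theorem exists_lieBasis (b : (rootSystem H).Base) :
    ∃ B : LieAlgebra.Basis b.support H, B.A = b.cartanMatrix := by
  classical
  have hnz : ∀ i : H.root, i.1.IsNonZero := LieSubalgebra.isNonZero_coe_root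
  choose h e f t he hf using fun i : b.support => exists_isSl2Triple_of_weight_isNonZero (hnz i.1)
  obtain rfl : h = fun i : b.support => ((coroot i.1.1 : H) : L) := by
    funext i; exact (t i).h_eq_coroot (hnz i.1) (he i) (hf i)
  have hf' : ∀ i : b.support, f i ∈ rootSpace H (-i.1.1 : Weight ℂ H L) := by
    intro i; have := hf i; rwa [← Weight.coe_neg] at this
  have hpair : ∀ i j : b.support, ((b.cartanMatrix i j : ℤ) : ℂ) = i.1.1 (coroot j.1.1) := by
    intro i j
    have := b.algebraMap_cartanMatrixIn_apply ℤ i j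
    simpa using this
  have hspanH : Submodule.span ℂ (Set.range fun i : b.support => coroot i.1.1) = (⊤ : Submodule ℂ H) := by
    have := b.toCoweightBasis.span_eq
    have h2 : (fun i : b.support => (coroot i.1.1 : H)) = b.toCoweightBasis := by
      funext i; rw [b.toCoweightBasis_apply]; rfl
    rw [h2]; exact this
  have hli : LinearIndependent ℂ (fun i : b.support => ((coroot i.1.1 : H) : L)) := by
    have h1 := b.toCoweightBasis.linearIndependent
    have h2 := h1.map' H.toSubmodule.subtype (Submodule.ker_subtype _)
    have h3 : (fun i : b.support => ((coroot i.1.1 : H) : L)) = H.toSubmodule.subtype ∘ b.toCoweightBasis := by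
      funext i; rw [Function.comp_apply, b.toCoweightBasis_apply]; rfl
    rw [h3]; exact h2
  have hab : ∀ x y : H, ⁅(x : L), (y : L)⁆ = 0 := by
    intro x y
    rw [← LieSubalgebra.coe_bracket, trivial_lie_zero]; rfl
  have hcar : H = LieSubalgebra.lieSpan ℂ L
      (Set.range fun i : b.support => ((coroot i.1.1 : H) : L)) := by
    apply LieSubalgebra.toSubmodule_injective
    rw [LieSubalgebra.coe_lieSpan_eq_span_of_forall_lie_eq_zero]
    · have h1 : Set.range (fun i : b.support => ((coroot i.1.1 : H) : L)) =
          H.toSubmodule.subtype '' (Set.range fun i : b.support => coroot i.1.1) := by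
        rw [← Set.range_comp]; rfl
      rw [h1, ← Submodule.map_span, hspanH, Submodule.map_top, Submodule.range_subtype]
    · rintro _ ⟨i, rfl⟩ _ ⟨j, rfl⟩
      exact hab _ _
  refine ⟨{ A := b.cartanMatrix, h := _, e := e, f := f, cartan_eq_lieSpan := hcar, span_ef := ?_, linInd := hli, nondegen := b.cartanMatrix_nondegenerate, sl2 := t, lie_h_h := fun i j => hab _ _, lie_h_e := ?_, lie_h_f := ?_, lie_e_f_ne := ?_ }, rfl⟩
  · set S := LieSubalgebra.lieSpan ℂ L (Set.range e ∪ Set.range f) with hSdef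
    have heS : ∀ i, e i ∈ S := fun i => LieSubalgebra.subset_lieSpan (Or.inl ⟨i, rfl⟩)
    have hfS : ∀ i, f i ∈ S := fun i => LieSubalgebra.subset_lieSpan (Or.inr ⟨i, rfl⟩)
    have hHS : ∀ x ∈ H, x ∈ S := by
      have : H ≤ S := by
        rw [hcar, LieSubalgebra.lieSpan_le]
        rintro _ ⟨i, rfl⟩
        have := S.lie_mem (heS i) (hfS i)
        rwa [(t i).lie_e_f] at this
      exact fun x hx => this hx
    have key : ∀ i : H.root, (∀ x ∈ rootSpace H i.1, x ∈ S) ∧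
        (∀ x ∈ rootSpace H (-i.1 : Weight ℂ H L), x ∈ S) := by
      intro i
      induction i using b.induction_add with
      | h₀ i hi =>
        have : ((rootSystem H).reflectionPerm i i).1 = -i.1 := by
          have h1 := (rootSystem H).root_reflectionPerm i i
          rw [(rootSystem H).reflection_apply_self] at h1
          ext x
          have := LinearMap.congr_fun h1 x
          exact this
        rw [this, neg_neg]
        exact hi.symm
      | h₁ i hi =>
        constructor
        · intro x hx
          obtain ⟨c, rfl⟩ := prop_of_mem (hnz i) (he ⟨i, hi⟩) (t ⟨i, hi⟩).e_ne_zero hx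
          exact S.smul_mem _ (heS _)
        · intro x hx
          obtain ⟨c, rfl⟩ := prop_of_mem (by simpa using hnz i) (hf' ⟨i, hi⟩) (t ⟨i, hi⟩).f_ne_zero hx
          exact S.smul_mem _ (hfS _)
      | h₂ i j k hk hi hj =>
        have hk' : (k.1 : H → ℂ) = i.1 + j.1 := by
          funext x
          have := LinearMap.congr_fun hk x
          simpa using this
        have hk'' : ((-k.1 : Weight ℂ H L) : H → ℂ) = (-i.1 : Weight ℂ H L) + (-j.1 : Weight ℂ H L) := by
          simp only [Weight.coe_neg, hk', neg_add]
        refine ⟨rootSpace_le_of_add (hnz i) (hnz j) (hnz k) hk' hi.1 ?_,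
          rootSpace_le_of_add (by simpa using hnz i) (by simpa using hnz j)
            (by simpa using hnz k) hk'' hi.2 ?_⟩
        · intro x hx
          obtain ⟨c, rfl⟩ := prop_of_mem (hnz j) (he ⟨j, hj⟩) (t ⟨j, hj⟩).e_ne_zero hx
          exact S.smul_mem _ (heS _)
        · intro x hx
          obtain ⟨c, rfl⟩ := prop_of_mem (by simpa using hnz j) (hf' ⟨j, hj⟩) (t ⟨j, hj⟩).f_ne_zero hx
          exact S.smul_mem _ (hfS _)
    have htop := LieModule.iSup_genWeightSpace_eq_top' ℂ H L
    rw [← LieSubmodule.toSubmodule_inj, LieSubmodule.iSup_toSubmodule, LieSubmodule.top_toSubmodule] at htop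
    apply LieSubalgebra.toSubmodule_injective
    rw [LieSubalgebra.top_toSubmodule, eq_top_iff, ← htop, iSup_le_iff]
    intro χ x hx
    by_cases h0 : χ.IsZero
    · have : x ∈ rootSpace H (0 : H → ℂ) := by
        have h2 : (χ : H → ℂ) = 0 := h0
        rw [← h2]; exact hx
      rw [LieAlgebra.rootSpace_zero_eq] at this
      exact hHS x this
    · exact (key ⟨χ, by simpa using h0⟩).1 x hx
  · intro i j
    have := lie_eq_smul_of_mem_rootSpace (he i) (coroot j.1.1)
    rw [← hpair, Int.cast_smul_eq_zsmul] at this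
    exact this
  · intro i j
    have := lie_eq_smul_of_mem_rootSpace (hf' i) (coroot j.1.1)
    rw [Weight.coe_neg, Pi.neg_apply, ← hpair, ← Int.cast_neg, Int.cast_smul_eq_zsmul] at this
    exact this
  · intro i j hij
    by_contra hne
    have hm := lie_mem_genWeightSpace_of_mem_genWeightSpace (he i) (hf j)
    have hbot : genWeightSpace L ((i.1.1 : H → ℂ) + -(j.1.1 : H → ℂ)) ≠ ⊥ := by
      intro h0; rw [h0] at hm; exact hne (by simpa using hm)
    let W : Weight ℂ H L := ⟨_, hbot⟩
    have hW : (W : H → ℂ) = (i.1.1 : H → ℂ) - j.1.1 := by rw [sub_eq_add_neg]; rfl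
    have hW0 : W.IsNonZero := by
      intro h0
      have h0' : (W : H → ℂ) = 0 := h0
      rw [hW, sub_eq_zero] at h0'
      exact hij (Subtype.ext (Subtype.ext (by exact DFunLike.coe_injective h0')))
    refine b.sub_notMem_range_root i.2 j.2 ⟨⟨W, by simpa using hW0⟩, ?_⟩
    ext x
    have := congrFun hW x
    simpa using this

end P3part
end Paper

namespace Paper
open Module
section P1part
open LieAlgebra LieAlgebra.IsKilling LieModule

lemma trace_contra {M : Type*} [AddCommGroup M] [Module ℂ M] (V : Submodule ℂ M)
    [FiniteDimensional ℂ V] (hV : V ≠ ⊥) (T z : Module.End ℂ M) (k : ℕ) (hk : k ≠ 0)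
    (hTi : Function.Injective T) (hT : ∀ m ∈ V, T m ∈ V) (hz : ∀ m ∈ V, z m ∈ V)
    (h : T * z = (z + (k : ℂ) • 1) * T) : False := by
  let T' : Module.End ℂ V := T.restrict hT
  let z' : Module.End ℂ V := z.restrict hz
  have hT'i : Function.Injective T' := by
    intro a b hab
    apply Subtype.ext
    apply hTi
    exact congrArg Subtype.val hab
  have h' : T' * z' = (z' + (k : ℂ) • 1) * T' := by
    ext v
    have := LinearMap.congr_fun h v.1
    exact this
  have hU : IsUnit T' := by
    rw [Module.End.isUnit_iff]
    exact ⟨hT'i, LinearMap.injective_iff_surjective.1 hT'i⟩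
  obtain ⟨u, hu⟩ := hU
  rw [← hu] at h'
  have h2 : z' = ↑u⁻¹ * ((z' + (k : ℂ) • 1) * (u : Module.End ℂ V)) := by
    rw [← h', Units.inv_mul_cancel_left]
  have h3 := congrArg (LinearMap.trace ℂ V) h2
  rw [LinearMap.trace_mul_comm, mul_assoc, Units.mul_inv, mul_one, map_add, map_smul,
    LinearMap.trace_one] at h3
  have h4 : (k : ℂ) * (finrank ℂ V : ℂ) = 0 := by
    simpa using h3
  have h5 : finrank ℂ V ≠ 0 := by
    intro h0
    exact hV (Submodule.finrank_eq_zero.1 h0)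
  have : (k : ℂ) ≠ 0 := by exact_mod_cast hk
  have : (finrank ℂ V : ℂ) ≠ 0 := by exact_mod_cast h5
  rcases mul_eq_zero.1 h4 with h6 | h6 <;> contradiction

variable {L : Type*} [LieRing L] [LieAlgebra ℂ L]

section Shift
variable {H : LieSubalgebra ℂ L} {M : Type*} [AddCommGroup M] [Module ℂ M]
  [LieRingModule L M] [LieModule ℂ L M]

/-- `T` moves weight spaces by `γ`. -/
def Shift (H : LieSubalgebra ℂ L) (T : Module.End ℂ M) (γ : Module.Dual ℂ H) : Prop :=
  ∀ μ : Module.Dual ℂ H, ∀ m ∈ wSpace H (M := M) μ, T m ∈ wSpace H (M := M) (μ + γ)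

lemma Shift.mul {T S : Module.End ℂ M} {γ δ : Module.Dual ℂ H} (hT : Shift H T γ)
    (hS : Shift H S δ) : Shift H (T * S) (γ + δ) := by
  intro μ m hm
  have := hT _ _ (hS _ _ hm)
  rwa [add_assoc, add_comm δ] at this

lemma shift_toEnd {x : L} {γ : Module.Dual ℂ H} (hx : x ∈ gSpace H γ) :
    Shift H (toEnd ℂ L M x) γ := by
  intro μ m hm h
  have h1 : ⁅(h : L), x⁆ = γ h • x := hx h
  have h2 : ⁅(h : L), m⁆ = μ h • m := hm h
  rw [toEnd_apply_apply, leibniz_lie, h1, h2, smul_lie, lie_smul, LinearMap.add_apply, add_smul,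
    add_comm]

lemma toEnd_lie' (x y : L) : toEnd ℂ L M ⁅x, y⁆ =
    toEnd ℂ L M x * toEnd ℂ L M y - toEnd ℂ L M y * toEnd ℂ L M x := by
  ext m
  exact lie_lie x y m

lemma exists_inv {x y : L} {γ : Module.Dual ℂ H} (hM : IsWeightModule H M)
    (hx : x ∈ gSpace H γ) (hy : y ∈ gSpace H (-γ))
    (hxi : Function.Injective (toEnd ℂ L M x)) (hyi : Function.Injective (toEnd ℂ L M y)) :
    ∃ T : Module.End ℂ M, T * toEnd ℂ L M x = 1 ∧ toEnd ℂ L M x * T = 1 ∧ Shift H T (-γ) ∧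
      Function.Injective T := by
  obtain ⟨-, htop, hfd⟩ := hM
  have hsur : ∀ μ : Module.Dual ℂ H, ∀ m ∈ wSpace H (M := M) μ,
      ∃ n ∈ wSpace H (M := M) (μ - γ), toEnd ℂ L M x n = m := by
    intro μ m hm
    have h1 : ∀ n ∈ wSpace H (M := M) (μ - γ), toEnd ℂ L M x n ∈ wSpace H (M := M) μ := by
      intro n hn; have := shift_toEnd (M := M) hx _ _ hn; rwa [sub_add_cancel] at this
    have h2 : ∀ n ∈ wSpace H (M := M) μ, toEnd ℂ L M y n ∈ wSpace H (M := M) (μ - γ) := by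
      intro n hn; have := shift_toEnd (M := M) hy _ _ hn; rwa [← sub_eq_add_neg] at this
    let F := (toEnd ℂ L M x).restrict h1
    let G := (toEnd ℂ L M y).restrict h2
    have hF : Function.Injective F := fun a b hab => Subtype.ext (hxi (congrArg Subtype.val hab))
    have hG : Function.Injective G := fun a b hab => Subtype.ext (hyi (congrArg Subtype.val hab))
    have := hfd μ
    have := hfd (μ - γ)
    have hd : finrank ℂ (wSpace H (M := M) (μ - γ)) = finrank ℂ (wSpace H (M := M) μ) :=
      le_antisymm (LinearMap.finrank_le_finrank_of_injective hF)
        (LinearMap.finrank_le_finrank_of_injective hG)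
    obtain ⟨n, hn⟩ := (LinearMap.injective_iff_surjective_of_finrank_eq_finrank hd).1 hF ⟨m, hm⟩
    exact ⟨n.1, n.2, congrArg Subtype.val hn⟩
  have hs : Function.Surjective (toEnd ℂ L M x) := by
    rw [← LinearMap.range_eq_top, eq_top_iff, ← htop, iSup_le_iff]
    intro μ m hm
    obtain ⟨n, -, hn⟩ := hsur μ m hm
    exact ⟨n, hn⟩
  let E := LinearEquiv.ofBijective (toEnd ℂ L M x) ⟨hxi, hs⟩
  have hE : ∀ m, toEnd ℂ L M x (E.symm m) = m := fun m => E.apply_symm_apply m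
  have hE' : ∀ m, E.symm (toEnd ℂ L M x m) = m := fun m => E.symm_apply_apply m
  refine ⟨E.symm.toLinearMap, ?_, ?_, ?_, E.symm.injective⟩
  · ext m; exact hE' m
  · ext m; exact hE m
  · intro μ m hm
    obtain ⟨n, hn, rfl⟩ := hsur μ m hm
    rw [← sub_eq_add_neg]
    change E.symm _ ∈ _
    rw [hE']
    exact hn

end Shift

/-- A root with the property of long roots. -/
def Long {ι V N : Type*} [AddCommGroup V] [Module ℂ V] [AddCommGroup N] [Module ℂ N]
    (P : RootPairing ι ℂ V N) [P.IsCrystallographic] (θ : ι) : Prop :=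
  ∀ γ, 2 ≤ P.pairingIn ℤ γ θ → γ = θ

lemma pairingIn_of_eq {ι V N : Type*} [AddCommGroup V] [Module ℂ V] [AddCommGroup N] [Module ℂ N]
    (P : RootPairing ι ℂ V N) [P.IsCrystallographic] {i j k : ι} (l : ι)
    (h : P.root k = P.root i + P.root j) :
    P.pairingIn ℤ k l = P.pairingIn ℤ i l + P.pairingIn ℤ j l := by
  have : (algebraMap ℤ ℂ) (P.pairingIn ℤ k l) = (algebraMap ℤ ℂ) (P.pairingIn ℤ i l + P.pairingIn ℤ j l) := by
    rw [map_add, P.algebraMap_pairingIn, P.algebraMap_pairingIn, P.algebraMap_pairingIn,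
      ← P.root_coroot_eq_pairing, ← P.root_coroot_eq_pairing, ← P.root_coroot_eq_pairing, h, map_add,
      LinearMap.add_apply]
  exact_mod_cast this

variable [FiniteDimensional ℂ L] [LieAlgebra.IsKilling ℂ L]
  {H : LieSubalgebra ℂ L} [H.IsCartanSubalgebra]

lemma mem_gSpace_of (i : H.root) {x : L} (hx : x ∈ rootSpace H i.1) :
    x ∈ gSpace H ((rootSystem H).root i) := by
  intro h
  exact lie_eq_smul_of_mem_rootSpace hx h

lemma isRoot_root (i : H.root) : IsRoot H ((rootSystem H).root i) := by
  refine ⟨(rootSystem H).ne_zero i, ?_⟩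
  obtain ⟨x, hx, hx0⟩ := i.1.exists_ne_zero
  intro h
  have := mem_gSpace_of i hx
  rw [h] at this
  exact hx0 (by simpa using this)

lemma lie_eq_zero_of_not_root {i j : H.root} {x y : L} (hx : x ∈ rootSpace H i.1)
    (hy : y ∈ rootSpace H j.1) (hne : (rootSystem H).root i + (rootSystem H).root j ≠ 0)
    (hn : ∀ k, (rootSystem H).root k ≠ (rootSystem H).root i + (rootSystem H).root j) :
    ⁅x, y⁆ = 0 := by
  by_contra h0
  have hm := lie_mem_genWeightSpace_of_mem_genWeightSpace hx hy
  have hbot : genWeightSpace L ((i.1 : H → ℂ) + (j.1 : H → ℂ)) ≠ ⊥ := by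
    intro h1; rw [h1] at hm; exact h0 (by simpa using hm)
  let W : Weight ℂ H L := ⟨_, hbot⟩
  have hW : (W : H → ℂ) = (i.1 : H → ℂ) + j.1 := rfl
  have hW0 : W.IsNonZero := by
    intro h1
    have h0' : (W : H → ℂ) = 0 := h1
    apply hne
    ext h
    have := congrFun h0' h
    exact this
  refine hn ⟨W, by simpa using hW0⟩ ?_
  ext h
  exact congrFun hW h

lemma lie_eq_zero_of_long {i j θ : H.root} (hθ : Long (rootSystem H) θ) {x y : L}
    (hx : x ∈ rootSpace H i.1) (hy : y ∈ rootSpace H j.1)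
    (hp : 2 ≤ (rootSystem H).pairingIn ℤ i θ + (rootSystem H).pairingIn ℤ j θ)
    (hne : (rootSystem H).root i + (rootSystem H).root j ≠ (rootSystem H).root θ) : ⁅x, y⁆ = 0 := by
  apply lie_eq_zero_of_not_root hx hy
  · intro h0
    have h1 : (rootSystem H).root i + (rootSystem H).root j = 0 := h0
    have : (algebraMap ℤ ℂ) ((rootSystem H).pairingIn ℤ i θ + (rootSystem H).pairingIn ℤ j θ) = 0 := by
      rw [map_add, (rootSystem H).algebraMap_pairingIn, (rootSystem H).algebraMap_pairingIn,
        ← (rootSystem H).root_coroot_eq_pairing, ← (rootSystem H).root_coroot_eq_pairing,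
        ← LinearMap.add_apply, ← map_add, h1, map_zero, LinearMap.zero_apply]
    have h3 : (rootSystem H).pairingIn ℤ i θ + (rootSystem H).pairingIn ℤ j θ = 0 := by
      simpa only [algebraMap_int_eq, eq_intCast, Int.cast_eq_zero] using this
    omega
  · intro k hk
    have h1 := pairingIn_of_eq (rootSystem H) θ hk
    have := hθ k (by omega)
    subst this
    exact hne hk.symm

theorem lemK {M : Type*} [AddCommGroup M] [Module ℂ M] [LieRingModule L M] [LieModule ℂ L M]
    [LieModule.IsIrreducible ℂ L M] (hM : IsWeightModule H M)
    (hcusp : ∀ α : Module.Dual ℂ H, IsRoot H α → IsCuspidalRoot H M α)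
    {θ A s2 s3 D : H.root} (hθ : Long (rootSystem H) θ)
    (hA : (rootSystem H).pairingIn ℤ A θ = 1) (h2 : (rootSystem H).pairingIn ℤ s2 θ = 1)
    (h3 : (rootSystem H).pairingIn ℤ s3 θ = 1) (hD : (rootSystem H).pairingIn ℤ D θ = 1)
    (hsum : (rootSystem H).root A + (rootSystem H).root s2 + (rootSystem H).root s3 =
      (rootSystem H).root D + (rootSystem H).root θ)
    (hA2 : (rootSystem H).root s2 + (rootSystem H).root A ≠ (rootSystem H).root θ)
    (hA3 : (rootSystem H).root s3 + (rootSystem H).root A ≠ (rootSystem H).root θ)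
    (hAD : (rootSystem H).root D + (rootSystem H).root A ≠ (rootSystem H).root θ)
    (hDA : D ≠ A) : False := by
  have hAA : A ≠ θ := by
    rintro rfl
    rw [(rootSystem H).pairingIn_same] at hA
    omega
  obtain ⟨B, hB⟩ := (rootSystem H).root_sub_root_mem_of_pairingIn_pos
    (i := θ) (j := A) (by rw [(rootSystem H).zero_lt_pairingIn_iff', hA]; norm_num) hAA.symm
  have hB' : (rootSystem H).root θ = (rootSystem H).root A + (rootSystem H).root B := by
    rw [hB]; abel
  have hθθ : (rootSystem H).pairingIn ℤ θ θ = 2 := (rootSystem H).pairingIn_same ..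
  have hBp : (rootSystem H).pairingIn ℤ B θ = 1 := by
    have := pairingIn_of_eq (rootSystem H) θ hB'
    omega
  have hnz : ∀ i : H.root, i.1.IsNonZero := LieSubalgebra.isNonZero_coe_root
  choose X hX hX0 using fun i : H.root => i.1.exists_ne_zero
  have hinj : ∀ (i : H.root) (x : L), x ∈ rootSpace H i.1 → x ≠ 0 →
      Function.Injective (toEnd ℂ L M x) := fun i x hx hx0 =>
    hcusp _ (isRoot_root i) x (mem_gSpace_of i hx) hx0
  have hinv : ∀ (i : H.root) (x : L), x ∈ rootSpace H i.1 → x ≠ 0 →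
      ∃ T : Module.End ℂ M, T * toEnd ℂ L M x = 1 ∧ toEnd ℂ L M x * T = 1 ∧
        Shift H T (-(rootSystem H).root i) ∧ Function.Injective T := by
    intro i x hx hx0
    let j := (rootSystem H).reflectionPerm i i
    have hj : (rootSystem H).root j = -(rootSystem H).root i := by
      rw [(rootSystem H).root_reflectionPerm, (rootSystem H).reflection_apply_self]
    refine exists_inv (y := X j) hM (mem_gSpace_of i hx) ?_ (hinj i x hx hx0) (hinj j _ (hX j) (hX0 j))
    rw [← hj]
    exact mem_gSpace_of j (hX j)
  -- the element e
  have he0 : ⁅X A, X B⁆ ≠ 0 := by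
    refine lie_ne_zero_of_add (γ := θ.1) (hnz A) (hnz B) ?_ (hX A) (hX0 A) (hX B) (hX0 B)
    funext h
    exact LinearMap.congr_fun hB' h
  have he : ⁅X A, X B⁆ ∈ rootSpace H θ.1 := by
    have h1 : (θ.1 : H → ℂ) = A.1 + B.1 := by
      funext h
      exact LinearMap.congr_fun hB' h
    rw [h1]
    exact lie_mem_genWeightSpace_of_mem_genWeightSpace (hX A) (hX B)
  obtain ⟨ei, hei1, hei2, heiS, heii⟩ := hinv θ _ he he0
  obtain ⟨di, hdi1, hdi2, hdiS, hdii⟩ := hinv D _ (hX D) (hX0 D)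
  -- commutation with `e`
  have hce : ∀ i, (rootSystem H).pairingIn ℤ i θ = 1 →
      Commute (toEnd ℂ L M (X i)) (toEnd ℂ L M ⁅X A, X B⁆) := by
    intro i hi
    have h0 : ⁅X i, ⁅X A, X B⁆⁆ = 0 := lie_eq_zero_of_long hθ (hX i) he (by omega) (by
      intro h0
      exact (rootSystem H).ne_zero i (by simp at h0))
    have := congrArg (toEnd ℂ L M) h0
    rw [toEnd_lie', map_zero, sub_eq_zero] at this
    exact this
  have hcomm : ∀ i j, (rootSystem H).pairingIn ℤ i θ = 1 → (rootSystem H).pairingIn ℤ j θ = 1 →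
      (rootSystem H).root i + (rootSystem H).root j ≠ (rootSystem H).root θ →
      Commute (toEnd ℂ L M (X i)) (toEnd ℂ L M (X j)) := by
    intro i j hi hj hne
    have h0 : ⁅X i, X j⁆ = 0 := lie_eq_zero_of_long hθ (hX i) (hX j) (by omega) hne
    have := congrArg (toEnd ℂ L M) h0
    rw [toEnd_lie', map_zero, sub_eq_zero] at this
    exact this
  have hmain : toEnd ℂ L M ⁅X A, X B⁆ = toEnd ℂ L M (X A) * toEnd ℂ L M (X B) -
      toEnd ℂ L M (X B) * toEnd ℂ L M (X A) := toEnd_lie' _ _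
  have hcei : ∀ i, (rootSystem H).pairingIn ℤ i θ = 1 → Commute (toEnd ℂ L M (X i)) ei := by
    intro i hi
    have := (hce i hi).eq
    calc toEnd ℂ L M (X i) * ei = (ei * toEnd ℂ L M ⁅X A, X B⁆) * (toEnd ℂ L M (X i) * ei) := by
          rw [hei1, one_mul]
      _ = ei * (toEnd ℂ L M ⁅X A, X B⁆ * toEnd ℂ L M (X i)) * ei := by noncomm_ring
      _ = ei * toEnd ℂ L M (X i) * (toEnd ℂ L M ⁅X A, X B⁆ * ei) := by rw [← this]; noncomm_ring
      _ = ei * toEnd ℂ L M (X i) := by rw [hei2, mul_one]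
  have hci : ∀ (i : H.root), (rootSystem H).root i + (rootSystem H).root B = (rootSystem H).root θ → i = A := by
    intro i hi
    apply (rootSystem H).root.injective
    rw [hB'] at hi
    exact add_right_cancel hi
  set z : Module.End ℂ M := toEnd ℂ L M (X A) * toEnd ℂ L M (X B) * ei with hz
  have hcz : ∀ i, (rootSystem H).pairingIn ℤ i θ = 1 → i ≠ A →
      (rootSystem H).root i + (rootSystem H).root A ≠ (rootSystem H).root θ →
      Commute (toEnd ℂ L M (X i)) z := by
    intro i hi hiA hne
    exact ((hcomm i A hi hA hne).mul_right (hcomm i B hi hBp fun h => hiA (hci i h))).mul_right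
      (hcei i hi)
  have hxz : toEnd ℂ L M (X A) * z = (z + (1 : ℂ) • 1) * toEnd ℂ L M (X A) := by
    have e1 := (hcei A hA).eq
    have e2 : toEnd ℂ L M (X A) * toEnd ℂ L M (X B) = toEnd ℂ L M (X B) * toEnd ℂ L M (X A) +
      toEnd ℂ L M ⁅X A, X B⁆ := by rw [hmain]; abel
    rw [hz, add_mul, one_smul, one_mul, mul_assoc _ ei, ← e1]
    calc toEnd ℂ L M (X A) * (toEnd ℂ L M (X A) * toEnd ℂ L M (X B) * ei)
        = toEnd ℂ L M (X A) * (toEnd ℂ L M (X A) * toEnd ℂ L M (X B)) * ei := by noncomm_ring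
      _ = toEnd ℂ L M (X A) * toEnd ℂ L M (X B) * (toEnd ℂ L M (X A) * ei) +
          toEnd ℂ L M (X A) * (toEnd ℂ L M ⁅X A, X B⁆ * ei) := by
          nth_rewrite 1 [e2]; noncomm_ring
      _ = _ := by rw [hei2, mul_one]
  have hck : ∀ i, (rootSystem H).pairingIn ℤ i θ = 1 →
      (rootSystem H).root i + (rootSystem H).root A ≠ (rootSystem H).root θ →
      ∃ k : ℕ, toEnd ℂ L M (X i) * z = (z + (k : ℂ) • 1) * toEnd ℂ L M (X i) := by
    intro i hi hne
    by_cases h : i = A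
    · subst h; exact ⟨1, by simpa using hxz⟩
    · exact ⟨0, by simpa using (hcz i hi h hne).eq⟩
  obtain ⟨k2, hk2⟩ := hck s2 h2 hA2
  obtain ⟨k3, hk3⟩ := hck s3 h3 hA3
  have hDz : di * z = z * di := by
    have := (hcz D hD hDA hAD).eq
    calc di * z = di * z * (toEnd ℂ L M (X D) * di) := by rw [hdi2, mul_one]
      _ = di * (z * toEnd ℂ L M (X D)) * di := by noncomm_ring
      _ = (di * toEnd ℂ L M (X D)) * z * di := by rw [← this]; noncomm_ring
      _ = z * di := by rw [hdi1, one_mul]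
  have hez : ei * z = z * ei := by
    have c1 := (hcei A hA).symm
    have c2 := (hcei B hBp).symm
    exact ((c1.mul_right c2).mul_right (Commute.refl ei)).eq
  set T : Module.End ℂ M := toEnd ℂ L M (X A) * (toEnd ℂ L M (X s2) * (toEnd ℂ L M (X s3) * (ei * di))) with hT
  have hTz : T * z = (z + ((1 + k2 + k3 : ℕ) : ℂ) • 1) * T := by
    have key : ∀ (u S : Module.End ℂ M) (a c : ℂ), u * z = (z + a • 1) * u → S * z = (z + c • 1) * S →
        (u * S) * z = (z + (a + c) • 1) * (u * S) := by
      intro u S a c hu hS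
      rw [mul_assoc, hS, ← mul_assoc, mul_add, hu, mul_smul_comm, mul_one, add_smul]
      simp only [add_mul, smul_mul_assoc, one_mul, mul_assoc, add_assoc]
    have h0 : (ei * di) * z = (z + (0 : ℂ) • 1) * (ei * di) := by
      rw [zero_smul, add_zero, mul_assoc, hDz, ← mul_assoc, hez, mul_assoc]
    have := key _ _ _ _ hxz (key _ _ _ _ hk2 (key _ _ _ _ hk3 h0))
    rw [hT, this]
    congr 3
    push_cast
    ring
  have hTi : Function.Injective T := by
    rw [hT]
    exact (hinj A _ (hX A) (hX0 A)).comp ((hinj s2 _ (hX s2) (hX0 s2)).comp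
      ((hinj s3 _ (hX s3) (hX0 s3)).comp (heii.comp hdii)))
  have hsX : ∀ i, Shift H (toEnd ℂ L M (X i)) ((rootSystem H).root i) :=
    fun i => shift_toEnd (mem_gSpace_of i (hX i))
  have hTS : Shift H T 0 := by
    have := (hsX A).mul ((hsX s2).mul ((hsX s3).mul (heiS.mul hdiS)))
    convert this using 1
    have h0 : (rootSystem H).root A + (rootSystem H).root s2 + (rootSystem H).root s3 -
      ((rootSystem H).root D + (rootSystem H).root θ) = 0 := by rw [hsum, sub_self]
    rw [← h0]
    abel
  have hzS : Shift H z 0 := by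
    have := ((hsX A).mul (hsX B)).mul heiS
    convert this using 1
    rw [hB']
    abel
  -- a nonzero weight space
  have hnt : Nontrivial M := LieModule.nontrivial_of_isIrreducible ℂ L M
  obtain ⟨μ, hμ⟩ : ∃ μ : Module.Dual ℂ H, wSpace H (M := M) μ ≠ ⊥ := by
    by_contra hcon
    push Not at hcon
    have := hM.2.1
    simp only [hcon, iSup_bot] at this
    exact bot_ne_top this
  have := hM.2.2 μ
  exact trace_contra (wSpace H (M := M) μ) hμ T z (1 + k2 + k3) (by omega) hTi
    (fun m hm => by have := hTS μ m hm; rwa [add_zero] at this)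
    (fun m hm => by have := hzS μ m hm; rwa [add_zero] at this) hTz

end P1part

end Paper

namespace Paper
open Module
section P2part
set_option linter.unusedSectionVars false
set_option linter.unusedSimpArgs false

variable {ι V N : Type*} [Finite ι] [AddCommGroup V] [Module ℂ V] [AddCommGroup N] [Module ℂ N]
    (P : RootPairing ι ℂ V N) [P.IsCrystallographic] [P.IsReduced] [P.IsRootSystem]

/-- The conclusion of the module theoretic argument. -/
def HK : Prop := ∀ θ A s2 s3 D : ι, Long P θ → P.pairingIn ℤ A θ = 1 → P.pairingIn ℤ s2 θ = 1 →
  P.pairingIn ℤ s3 θ = 1 → P.pairingIn ℤ D θ = 1 →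
  P.root A + P.root s2 + P.root s3 = P.root D + P.root θ →
  P.root s2 + P.root A ≠ P.root θ → P.root s3 + P.root A ≠ P.root θ →
  P.root D + P.root A ≠ P.root θ → D ≠ A → False

variable {P}

lemma crp (i l : ι) : P.coroot' l (P.root i) = (P.pairingIn ℤ i l : ℂ) := by
  have := P.algebraMap_pairingIn ℤ i l
  rw [P.root_coroot'_eq_pairing, ← this]; rfl

lemma rtp (i l : ι) : P.root' i (P.coroot l) = (P.pairingIn ℤ i l : ℂ) := by
  have := P.algebraMap_pairingIn ℤ i l
  rw [P.root'_coroot_eq_pairing, ← this]; rfl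

lemma root_refl (i j : ι) : P.root (P.reflectionPerm i j) =
    P.root j - (P.pairingIn ℤ j i : ℂ) • P.root i := by
  rw [P.root_reflectionPerm, P.reflection_apply_root, ← P.algebraMap_pairingIn ℤ]; rfl

lemma coroot_refl (i j : ι) : P.coroot (P.reflectionPerm i j) =
    P.coroot j - (P.pairingIn ℤ i j : ℂ) • P.coroot i := by
  rw [P.coroot_reflectionPerm, P.coreflection_apply_coroot, ← P.algebraMap_pairingIn ℤ]; rfl

lemma root_neg' (i : ι) : P.root (P.reflectionPerm i i) = - P.root i := by
  rw [P.root_reflectionPerm, P.reflection_apply_self]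

lemma pair_neg' (i j : ι) : P.pairingIn ℤ (P.reflectionPerm i i) j = - P.pairingIn ℤ i j :=
  P.pairingIn_reflectionPerm_self_left ℤ i j

lemma Long.refl {θ : ι} (h : Long P θ) (i : ι) : Long P (P.reflectionPerm i θ) := by
  intro γ hγ
  rw [P.pairingIn_reflectionPerm] at hγ
  have := h _ hγ
  rw [← this, P.reflectionPerm_self]

lemma Long.neg {θ : ι} (h : Long P θ) (γ : ι) (hγ : P.pairingIn ℤ γ θ ≤ -2) :
    P.root γ = - P.root θ := by
  have := h (P.reflectionPerm γ γ) (by rw [pair_neg']; omega)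
  rw [← this, root_neg', neg_neg]

variable (b : P.Base)

/-- Height functional. -/
noncomputable def htf : V →ₗ[ℂ] ℂ := b.toWeightBasis.constr ℂ (fun _ => (1 : ℂ))

lemma htf_root (i : b.support) : htf b (P.root i) = 1 := by
  rw [← b.toWeightBasis_apply, htf, Basis.constr_basis]

lemma exists_long [Nonempty ι] : ∃ c : b.support, Long P c := by
  have : Fintype ι := Fintype.ofFinite ι
  obtain ⟨θ, hθ⟩ : ∃ θ, ∀ γ, (P.posRootForm ℤ).rootLength γ ≤ (P.posRootForm ℤ).rootLength θ :=
    Finite.exists_max _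
  have hl : Long P θ := by
    intro γ hγ
    by_contra hne
    have h1 : P.root γ ≠ P.root θ := fun h => hne (P.root.injective h)
    have h2 : P.root γ ≠ - P.root θ := by
      intro h
      have := congrArg (P.coroot' θ) h
      rw [map_neg, crp, crp, P.pairingIn_same] at this
      norm_cast at this
      omega
    have := RootPairing.RootPositiveForm.rootLength_lt_of_pairingIn_notMem (P.posRootForm ℤ) h1 h2 (by
      simp; omega)
    exact absurd (hθ γ) (not_le.2 this)
  have key : ∀ i, Long P i → ∃ c : b.support, Long P c := by
    intro i
    induction i using b.induction_reflect with
    | h₀ i hi =>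
      intro h
      have := h.refl i
      rw [P.reflectionPerm_self] at this
      exact hi this
    | h₁ i hi => exact fun h => ⟨⟨i, hi⟩, h⟩
    | h₂ i j hi hj =>
      intro h
      have := h.refl j
      rw [P.reflectionPerm_self] at this
      exact hi this
  exact key θ hl

lemma kprime (hK : HK P) {c a b' d : b.support} (hc : Long P c) (ha : P.pairingIn ℤ a c = -1)
    (hb : P.pairingIn ℤ b' c = -1) (hd : P.pairingIn ℤ d c = -1) {k : ι}
    (hk : P.root k = P.root c + P.root a + P.root b' + P.root d) : False := by
  have hcc : P.pairingIn ℤ (c : ι) c = 2 := P.pairingIn_same ..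
  have hkc : P.pairingIn ℤ k c = -1 := by
    have := congrArg (P.coroot' c) hk
    simp only [map_add, crp, ha, hb, hd, hcc] at this
    norm_cast at this
  refine hK c (P.reflectionPerm a a) (P.reflectionPerm b' b') (P.reflectionPerm d d)
    (P.reflectionPerm k k) hc ?_ ?_ ?_ ?_ ?_ ?_ ?_ ?_ ?_
  · rw [pair_neg', ha]; rfl
  · rw [pair_neg', hb]; rfl
  · rw [pair_neg', hd]; rfl
  · rw [pair_neg', hkc]; rfl
  · simp only [root_neg', hk]; abel
  · intro h
    have := congrArg (htf b) h
    simp only [root_neg', map_add, map_neg, htf_root] at this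
    norm_num at this
  · intro h
    have := congrArg (htf b) h
    simp only [root_neg', map_add, map_neg, htf_root] at this
    norm_num at this
  · intro h
    have := congrArg (htf b) h
    simp only [root_neg', hk, map_add, map_neg, htf_root] at this
    norm_num at this
  · intro h
    have := congrArg (fun i => htf b (P.root i)) h
    simp only [root_neg', hk, map_add, map_neg, htf_root] at this
    norm_num at this

lemma neg_ne_simple (c d : b.support) : P.root c ≠ - P.root d := by
  intro h
  have := congrArg (htf b) h
  simp only [map_neg, htf_root] at this
  norm_num at this

lemma pair_cases {i j : b.support} (hij : i ≠ j) :
    (P.pairingIn ℤ i j = 0 ∧ P.pairingIn ℤ j i = 0) ∨ (P.pairingIn ℤ i j = -1 ∧ P.pairingIn ℤ j i = -1) ∨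
    (P.pairingIn ℤ i j = -1 ∧ P.pairingIn ℤ j i = -2) ∨ (P.pairingIn ℤ i j = -2 ∧ P.pairingIn ℤ j i = -1) ∨
    (P.pairingIn ℤ i j = -1 ∧ P.pairingIn ℤ j i = -3) ∨ (P.pairingIn ℤ i j = -3 ∧ P.pairingIn ℤ j i = -1) := by
  have h1 := P.pairingIn_pairingIn_mem_set_of_isCrystal_of_isRed' (i : ι) j
    (fun h => hij (Subtype.ext (P.root.injective h))) (neg_ne_simple b i j)
  have h2 : P.pairingIn ℤ i j ≤ 0 := b.pairingIn_le_zero_of_ne (fun h => hij (Subtype.ext h)) i.2 j.2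
  simp only [Set.mem_insert_iff, Set.mem_singleton_iff, Prod.mk.injEq] at h1
  omega

lemma pair_np {i j : b.support} (hij : i ≠ j) : P.pairingIn ℤ i j ≤ 0 := by
  have := pair_cases b hij
  omega

lemma pair_neg_symm {i j : b.support} (hij : i ≠ j) (h : P.pairingIn ℤ i j = -1) :
    P.pairingIn ℤ j i < 0 := by
  have := pair_cases b hij
  omega

/-- Pairing with a long simple root. -/
lemma long_cases {c a : b.support} (hc : Long P c) (hac : a ≠ c) :
    (P.pairingIn ℤ a c = 0 ∧ P.pairingIn ℤ c a = 0) ∨ (P.pairingIn ℤ a c = -1 ∧ P.pairingIn ℤ c a = -1) ∨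
    (P.pairingIn ℤ a c = -1 ∧ P.pairingIn ℤ c a = -2) ∨ (P.pairingIn ℤ a c = -1 ∧ P.pairingIn ℤ c a = -3) := by
  have h1 := pair_cases b hac
  have h2 : ¬ P.pairingIn ℤ a c ≤ -2 := fun h => neg_ne_simple b a c (hc.neg a h)
  omega

lemma n1 (hK : HK P) {c a : b.support} (hc : Long P c) (h : P.pairingIn ℤ a c = -1) :
    P.pairingIn ℤ c a ≠ -3 := by
  intro h3
  refine kprime b hK hc h h h (k := P.reflectionPerm a c) ?_
  rw [root_refl, h3]
  push_cast
  module

lemma n2 (hK : HK P) {c a d : b.support} (hc : Long P c) (h : P.pairingIn ℤ a c = -1)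
    (h2 : P.pairingIn ℤ c a = -2) (hd : P.pairingIn ℤ d c = -1) (hda : d ≠ a) : False := by
  have hdc : d ≠ c := by rintro rfl; rw [P.pairingIn_same] at hd; omega
  have r1 : P.root (P.reflectionPerm a c) = P.root c + (2 : ℂ) • P.root a := by
    rw [root_refl, h2]
    push_cast
    module
  have p1 : P.pairingIn ℤ (P.reflectionPerm a c) d < 0 := by
    have := congrArg (P.coroot' d) r1
    simp only [map_add, map_smul, crp, smul_eq_mul] at this
    norm_cast at this
    have := pair_np b hda.symm
    have := pair_neg_symm b hdc hd
    omega
  obtain ⟨k, hk⟩ := P.root_add_root_mem_of_pairingIn_neg p1 (by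
    intro h
    have := congrArg (htf b) h
    simp only [r1, map_neg, map_add, map_smul, htf_root] at this
    norm_num at this)
  refine kprime b hK hc h h hd (k := k) ?_
  rw [hk, r1]
  module

lemma n3 (hK : HK P) {c a d e : b.support} (hc : Long P c) (h1 : P.pairingIn ℤ a c = -1)
    (h2 : P.pairingIn ℤ d c = -1) (h3 : P.pairingIn ℤ e c = -1) (had : a ≠ d) (hae : a ≠ e)
    (hde : d ≠ e) : False := by
  have hcc : P.pairingIn ℤ (c : ι) c = 2 := P.pairingIn_same ..
  have hac : a ≠ c := by rintro rfl; omega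
  have hdc : d ≠ c := by rintro rfl; omega
  have hec : e ≠ c := by rintro rfl; omega
  have q1 := pair_np b had
  have q2 := pair_np b hae
  have q3 := pair_np b hde
  have q4 := pair_neg_symm b hac h1
  have q5 := pair_neg_symm b hdc h2
  have q6 := pair_neg_symm b hec h3
  obtain ⟨k1, hk1⟩ := P.root_add_root_mem_of_pairingIn_neg (i := c) (j := a) (by omega)
    (neg_ne_simple b c a)
  have p1 : P.pairingIn ℤ k1 d < 0 := by
    have := congrArg (P.coroot' d) hk1
    simp only [map_add, map_smul, crp, smul_eq_mul] at this
    norm_cast at this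
    omega
  obtain ⟨k2, hk2⟩ := P.root_add_root_mem_of_pairingIn_neg p1 (by
    intro h
    have := congrArg (htf b) h
    simp only [hk1, map_neg, map_add, map_smul, htf_root] at this
    norm_num at this)
  have p2 : P.pairingIn ℤ k2 e < 0 := by
    have := congrArg (P.coroot' e) hk2
    simp only [hk1, map_add, map_smul, crp, smul_eq_mul] at this
    norm_cast at this
    omega
  obtain ⟨k3, hk3⟩ := P.root_add_root_mem_of_pairingIn_neg p2 (by
    intro h
    have := congrArg (htf b) h
    simp only [hk2, hk1, map_neg, map_add, map_smul, htf_root] at this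
    norm_num at this)
  exact kprime b hK hc h1 h2 h3 (k := k3) (by rw [hk3, hk2, hk1])

/-- equal length neighbours of long roots are long -/
lemma long_of_adj {l a : b.support} (hl : Long P l) (h1 : P.pairingIn ℤ a l = -1)
    (h2 : P.pairingIn ℤ l a = -1) : Long P a := by
  have := (hl.refl a).refl l
  have e : P.reflectionPerm l (P.reflectionPerm a l) = a := by
    apply P.root.injective
    have hp : P.pairingIn ℤ (P.reflectionPerm a l) l = 1 := by
      have := congrArg (P.coroot' l) (root_refl (P := P) a l)
      simp only [map_sub, map_smul, crp, smul_eq_mul, h1, h2, P.pairingIn_same] at this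
      norm_cast at this
    rw [root_refl, hp, root_refl, h2]
    push_cast
    module
  rwa [e] at this

end P2part
section P2bpart
set_option linter.unusedSectionVars false

variable {ι V N : Type*} [Finite ι] [AddCommGroup V] [Module ℂ V] [AddCommGroup N] [Module ℂ N]
    {P : RootPairing ι ℂ V N} [P.IsCrystallographic] [P.IsReduced] [P.IsRootSystem]

/-- Entries of the Cartan matrices of types A and C. -/
def cN (ε : ℤ) (i j : ℕ) : ℤ :=
  if i = j then 2 else if i + 1 = j ∨ j + 1 = i then (if i = 0 then -ε else -1) else 0

variable (b : P.Base)

/-- A sequence of simple roots with prescribed pairings. -/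
def Good (ε : ℤ) (n : ℕ) (s : ℕ → b.support) : Prop :=
  ∀ i < n, ∀ j < n, P.pairingIn ℤ (s i) (s j) = cN ε i j

variable {b}

lemma Good.ne {ε : ℤ} (hε : ε = 1 ∨ ε = 2) {n : ℕ} {s : ℕ → b.support} (h : Good b ε n s) {i j : ℕ}
    (hi : i < n) (hj : j < n) (hij : i ≠ j) : s i ≠ s j := by
  intro e
  have h1 := h i hi j hj
  rw [e, P.pairingIn_same] at h1
  unfold cN at h1
  split_ifs at h1 <;> omega

/-- weights -/
def wN (ε : ℤ) (j : ℕ) : ℤ := if j = 0 then 1 else ε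

lemma Good.exists_t {ε : ℤ} {n : ℕ} {s : ℕ → b.support} (h : Good b ε n s) (hl : Long P (s 0)) :
    ∀ m < n, ∃ t : ι, Long P t ∧
      P.root t = ∑ j ∈ Finset.range (m + 1), (wN ε j : ℂ) • P.root (s j) ∧
      P.coroot t = ∑ j ∈ Finset.range (m + 1), P.coroot (s j) := by
  intro m
  induction m with
  | zero => intro _; exact ⟨s 0, hl, by simp [wN], by simp⟩
  | succ m ih =>
    intro hm
    obtain ⟨t, ht, hr, hcr⟩ := ih (by omega)
    refine ⟨P.reflectionPerm (s (m+1)) t, ht.refl _, ?_, ?_⟩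
    · have h1 : (P.pairingIn ℤ t (s (m+1)) : ℂ) = - (wN ε (m+1) : ℂ) := by
        rw [← crp, hr, map_sum, Finset.sum_eq_single m]
        · rw [map_smul, crp, h m (by omega) (m+1) hm]
          by_cases h0 : m = 0 <;> simp [cN, wN, h0]
        · intro j hj hjm
          rw [Finset.mem_range] at hj
          rw [map_smul, crp, h j (by omega) (m+1) hm]
          have : cN ε j (m+1) = 0 := by
            unfold cN
            rw [if_neg (by omega), if_neg (by omega)]
          rw [this]; simp
        · intro hh; simp at hh
      rw [root_refl, h1, Finset.sum_range_succ _ (m+1), hr]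
      module
    · have h1 : (P.pairingIn ℤ (s (m+1)) t : ℂ) = - 1 := by
        rw [← rtp, hcr, map_sum, Finset.sum_eq_single m]
        · rw [rtp, h (m+1) hm m (by omega)]
          simp [cN]
        · intro j hj hjm
          rw [Finset.mem_range] at hj
          rw [rtp, h (m+1) hm j (by omega)]
          have : cN ε (m+1) j = 0 := by
            unfold cN
            rw [if_neg (by omega), if_neg (by omega)]
          rw [this]; simp
        · intro hh; simp at hh
      rw [coroot_refl, h1, Finset.sum_range_succ _ (m+1), hcr]
      module

lemma pair_t {m : ℕ} {s : ℕ → b.support} {t : ι} (c : ι)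
    (hcr : P.coroot t = ∑ j ∈ Finset.range (m + 1), P.coroot (s j)) :
    P.pairingIn ℤ c t = ∑ j ∈ Finset.range (m + 1), P.pairingIn ℤ c (s j) := by
  have h1 : (P.pairingIn ℤ c t : ℂ) = ∑ j ∈ Finset.range (m + 1), (P.pairingIn ℤ c (s j) : ℂ) := by
    rw [← rtp, hcr, map_sum]
    exact Finset.sum_congr rfl fun j _ => rtp _ _
  exact_mod_cast h1

lemma pair_t' {ε : ℤ} {m : ℕ} {s : ℕ → b.support} {t : ι} (c : ι)
    (hr : P.root t = ∑ j ∈ Finset.range (m + 1), (wN ε j : ℂ) • P.root (s j)) :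
    P.pairingIn ℤ t c = ∑ j ∈ Finset.range (m + 1), wN ε j * P.pairingIn ℤ (s j) c := by
  have h1 : (P.pairingIn ℤ t c : ℂ) =
      ∑ j ∈ Finset.range (m + 1), (wN ε j : ℂ) * (P.pairingIn ℤ (s j) c : ℂ) := by
    rw [← crp, hr, map_sum]
    exact Finset.sum_congr rfl fun j _ => by rw [map_smul, crp, smul_eq_mul]
  exact_mod_cast h1

lemma ht_t {ε : ℤ} (hε : ε = 1 ∨ ε = 2) {m : ℕ} {s : ℕ → b.support} {t : ι}
    (hr : P.root t = ∑ j ∈ Finset.range (m + 1), (wN ε j : ℂ) • P.root (s j)) :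
    ∃ k : ℕ, htf b (P.root t) = k := by
  refine ⟨∑ j ∈ Finset.range (m+1), (wN ε j).toNat, ?_⟩
  rw [hr, map_sum, Nat.cast_sum]
  refine Finset.sum_congr rfl fun j _ => ?_
  rw [map_smul, htf_root, smul_eq_mul, mul_one]
  have : ((wN ε j).toNat : ℤ) = wN ε j := Int.toNat_of_nonneg (by unfold wN; split_ifs <;> omega)
  rw [← Int.cast_natCast, this]

lemma adj_unique {ε : ℤ} (hε : ε = 1 ∨ ε = 2) {n : ℕ} {s : ℕ → b.support} (h : Good b ε n s)
    (hl : Long P (s 0)) {c : b.support} (hc : ∀ i < n, c ≠ s i) {i : ℕ} (hi : i < n)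
    (hci : P.pairingIn ℤ c (s i) ≠ 0) :
    P.pairingIn ℤ c (s i) = -1 ∧ ∀ j < n, j ≠ i → P.pairingIn ℤ c (s j) = 0 ∧ P.pairingIn ℤ (s j) c = 0 := by
  obtain ⟨t, ht, hr, hcr⟩ := h.exists_t hl (n-1) (by omega)
  have hp := pair_t (c : ι) hcr
  have hge : ¬ P.pairingIn ℤ c t ≤ -2 := by
    intro h2
    have := congrArg (htf b) (ht.neg _ h2)
    obtain ⟨k, hk⟩ := ht_t hε hr
    rw [htf_root, map_neg, hk] at this
    have h3 : ((1 + k : ℕ) : ℂ) = 0 := by push_cast; rw [this]; ring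
    have h4 : 1 + k = 0 := by exact_mod_cast h3
    omega
  rw [hp, show n - 1 + 1 = n by omega] at hge
  have hnp : ∀ j ∈ Finset.range n, P.pairingIn ℤ c (s j) ≤ 0 := by
    intro j hj
    exact pair_np b (hc j (Finset.mem_range.1 hj))
  have hi' := Finset.mem_range.2 hi
  rw [← Finset.add_sum_erase _ _ hi'] at hge
  have hnp2 : ∀ j ∈ (Finset.range n).erase i, P.pairingIn ℤ c (s j) ≤ 0 :=
    fun j hj => hnp j (Finset.mem_of_mem_erase hj)
  have hs := Finset.sum_nonpos hnp2
  have hi0 := hnp i hi'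
  refine ⟨by omega, ?_⟩
  intro j hj hji
  have h0 : ∑ j ∈ (Finset.range n).erase i, P.pairingIn ℤ c (s j) = 0 := by omega
  rw [Finset.sum_eq_zero_iff_of_nonpos hnp2] at h0
  have hz := h0 j (Finset.mem_erase.2 ⟨hji, Finset.mem_range.2 hj⟩)
  refine ⟨hz, ?_⟩
  have := pair_cases b (hc j hj)
  omega

lemma Good.extend {ε : ℤ} {n : ℕ} (hn : 1 ≤ n) {s : ℕ → b.support} (h : Good b ε n s)
    {c : b.support} (h0 : ∀ j < n, j ≠ n - 1 → P.pairingIn ℤ c (s j) = 0 ∧ P.pairingIn ℤ (s j) c = 0)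
    (h1 : P.pairingIn ℤ c (s (n-1)) = -1)
    (h2 : P.pairingIn ℤ (s (n-1)) c = if n - 1 = 0 then -ε else -1) :
    Good b ε (n+1) (fun i => if i = n then c else s i) := by
  intro i hi j hj
  by_cases hin : i = n
  · by_cases hjn : j = n
    · subst hin; subst hjn
      simp [cN]
    · simp only [hin, hjn, if_true, if_false]
      by_cases hj1 : j = n - 1
      · rw [hj1, h1]; unfold cN
        rw [if_neg (by omega), if_pos (by omega), if_neg (by omega)]
      · rw [(h0 j (by omega) hj1).1]
        unfold cN
        rw [if_neg (by omega), if_neg (by omega)]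
  · by_cases hjn : j = n
    · simp only [hin, hjn, if_true, if_false]
      by_cases hj1 : i = n - 1
      · have h3 : cN ε (n-1) n = if n - 1 = 0 then -ε else -1 := by
          unfold cN
          rw [if_neg (by omega), if_pos (by omega)]
        rw [hj1, h2, h3]
      · rw [(h0 i (by omega) hj1).2]
        unfold cN
        rw [if_neg (by omega), if_neg (by omega)]
    · simp only [hin, hjn, if_false]
      exact h i (by omega) j (by omega)

lemma exists_adj [P.IsIrreducible] {n : ℕ} (hn : 1 ≤ n) {s : ℕ → b.support}
    (hx : ∃ x, ∀ i < n, x ≠ s i) :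
    ∃ c, (∀ i < n, c ≠ s i) ∧ ∃ i < n, P.pairingIn ℤ c (s i) ≠ 0 := by
  by_contra hcon
  push Not at hcon
  obtain ⟨x, hx⟩ := hx
  have := b.induction_on_cartanMatrix (fun y => ∃ i < n, y = s i) (i := s 0) (j := x)
    ⟨0, by omega, rfl⟩ (by
      rintro i j ⟨k, hk, rfl⟩ hj
      by_contra hno
      push Not at hno
      exact hj (hcon j hno k hk))
  obtain ⟨i, hi, e⟩ := this
  exact hx i hi e

lemma extendA (hK : HK P) [P.IsIrreducible] (hall : ∀ c : b.support, Long P c) {n : ℕ} (hn : 1 ≤ n)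
    {s : ℕ → b.support} (h : Good b 1 n s) (hx : ∃ x, ∀ i < n, x ≠ s i) :
    ∃ s', Good b 1 (n+1) s' := by
  obtain ⟨c, hc, i, hi, hci⟩ := exists_adj hn hx
  obtain ⟨h1, h0⟩ := adj_unique (Or.inl rfl) h (hall _) hc hi hci
  have h2 : P.pairingIn ℤ (s i) c = -1 := by
    have h3 := long_cases b (hall (s i)) (hc i hi)
    have h4 := long_cases b (hall c) (hc i hi).symm
    omega
  by_cases hin : i = n - 1
  · subst hin
    exact ⟨_, h.extend hn h0 h1 (by rw [h2]; split_ifs <;> rfl)⟩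
  by_cases hi0 : i = 0
  · subst hi0
    have hrev : Good b 1 n (fun j => s (n - 1 - j)) := by
      intro j hj k hk
      simp only
      rw [h _ (by omega) _ (by omega)]
      unfold cN
      split_ifs <;> omega
    refine ⟨_, hrev.extend hn (c := c) (fun j hj hjn => h0 _ (by omega) (by omega)) ?_ ?_⟩
    · simpa using h1
    · simp only [Nat.sub_self]; rw [h2]; split_ifs <;> rfl
  exfalso
  have e1 : P.pairingIn ℤ (s (i-1)) (s i) = -1 := by
    rw [h _ (by omega) _ hi]; unfold cN; split_ifs <;> omega
  have e2 : P.pairingIn ℤ (s (i+1)) (s i) = -1 := by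
    rw [h _ (by omega) _ hi]; unfold cN; split_ifs <;> omega
  exact n3 b hK (hall (s i)) h1 e1 e2 (hc _ (by omega)) (hc _ (by omega))
    (h.ne (Or.inl rfl) (by omega) (by omega) (by omega))

lemma extendC (hK : HK P) [P.IsIrreducible] {n : ℕ} (hn : 2 ≤ n)
    {s : ℕ → b.support} (hl : Long P (s 0)) (h : Good b 2 n s) (hx : ∃ x, ∀ i < n, x ≠ s i) :
    ∃ s', Long P (s' 0) ∧ Good b 2 (n+1) s' := by
  obtain ⟨c, hc, i, hi, hci⟩ := exists_adj (by omega) hx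
  obtain ⟨h1, h0⟩ := adj_unique (Or.inr rfl) h hl hc hi hci
  have hneg := pair_neg_symm b (hc i hi) h1
  have hi0 : i ≠ 0 := by
    rintro rfl
    refine n2 b hK hl (a := s 1) ?_ ?_ h1 (hc 1 (by omega))
    · rw [h _ (by omega) _ (by omega)]; rfl
    · rw [h _ (by omega) _ (by omega)]; rfl
  obtain ⟨t, ht, hr, hcr⟩ := h.exists_t hl i hi
  obtain ⟨k, hk⟩ := ht_t (Or.inr rfl) hr
  have hct : P.pairingIn ℤ c t = -1 := by
    rw [pair_t (c : ι) hcr, Finset.sum_eq_single i, h1]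
    · intro j hj hji
      rw [Finset.mem_range] at hj
      exact (h0 j (by omega) hji).1
    · intro hh; simp at hh
  have htc : P.pairingIn ℤ t c = 2 * P.pairingIn ℤ (s i) c := by
    rw [pair_t' (c : ι) hr, Finset.sum_eq_single i]
    · simp [wN, hi0]
    · intro j hj hji
      rw [Finset.mem_range] at hj
      rw [(h0 j (by omega) hji).2, mul_zero]
    · intro hh; simp at hh
  have hin : i = n - 1 := by
    by_contra hin
    have hdt : P.pairingIn ℤ (s (i+1)) t = -1 := by
      rw [pair_t _ hcr, Finset.sum_eq_single i]
      · rw [h _ (by omega) _ hi]; unfold cN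
        rw [if_neg (by omega), if_pos (by omega), if_neg (by omega)]
      · intro j hj hji
        rw [Finset.mem_range] at hj
        rw [h _ (by omega) _ (by omega)]; unfold cN; split_ifs <;> omega
      · intro hh; simp at hh
    have htd : P.pairingIn ℤ t (s (i+1)) = -2 := by
      rw [pair_t' _ hr, Finset.sum_eq_single i]
      · rw [h _ (by omega) _ (by omega)]
        have h3 : cN 2 i (i+1) = -1 := by
          unfold cN; rw [if_neg (by omega), if_pos (by omega), if_neg hi0]
        rw [h3]; unfold wN; rw [if_neg hi0]; norm_num
      · intro j hj hji
        rw [Finset.mem_range] at hj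
        rw [h _ (by omega) _ (by omega)]
        have : cN 2 j (i+1) = 0 := by
          unfold cN; rw [if_neg (by omega), if_neg (by omega)]
        rw [this, mul_zero]
      · intro hh; simp at hh
    have hcd := (h0 (i+1) (by omega) (by omega)).1
    set m : ℤ := - P.pairingIn ℤ t c with hm
    have r1 : P.root (P.reflectionPerm c t) = P.root t + (m : ℂ) • P.root c := by
      rw [root_refl, hm]; push_cast; module
    have p1 : P.pairingIn ℤ (P.reflectionPerm c t) (s (i+1)) = -2 := by
      have := congrArg (P.coroot' (s (i+1))) r1
      simp only [map_add, map_smul, crp, smul_eq_mul, htd, hcd] at this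
      norm_cast at this
      simpa using this
    have r2 : P.root (P.reflectionPerm (s (i+1)) (P.reflectionPerm c t)) =
        P.root t + (m : ℂ) • P.root c + (2 : ℂ) • P.root (s (i+1)) := by
      rw [root_refl, p1, r1]; push_cast; module
    have p2 : P.pairingIn ℤ (P.reflectionPerm (s (i+1)) (P.reflectionPerm c t)) t = - m := by
      have := congrArg (P.coroot' t) r2
      simp only [map_add, map_smul, crp, smul_eq_mul, hct, hdt, P.pairingIn_same] at this
      push_cast at this
      have h3 : (P.pairingIn ℤ (P.reflectionPerm (s (i+1)) (P.reflectionPerm c t)) t : ℂ) = ((-m : ℤ) : ℂ) := by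
        push_cast; rw [this]; ring
      exact_mod_cast h3
    have := congrArg (htf b) (ht.neg _ (by omega : P.pairingIn ℤ (P.reflectionPerm (s (i+1)) (P.reflectionPerm c t)) t ≤ -2))
    rw [r2] at this
    simp only [map_add, map_neg, map_smul, htf_root, hk, smul_eq_mul] at this
    have h5 : (((k : ℤ) + m + 2 + k : ℤ) : ℂ) = 0 := by
      push_cast; linear_combination this
    have h6 : (k : ℤ) + m + 2 + k = 0 := by exact_mod_cast h5
    omega
  have hs : P.pairingIn ℤ (s i) c = -1 := by
    have h7 := P.pairingIn_pairingIn_mem_set_of_isCrystal_of_isRed' (c : ι) t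
      (by
        intro e
        have := congrArg (P.coroot' c) e
        rw [crp, crp, P.pairingIn_same] at this
        norm_cast at this
        omega)
      (by
        intro e
        have := congrArg (htf b) e
        rw [htf_root, map_neg, hk] at this
        have h3 : ((1 + k : ℕ) : ℂ) = 0 := by push_cast; rw [this]; ring
        have h4 : 1 + k = 0 := by exact_mod_cast h3
        omega)
    simp only [Set.mem_insert_iff, Set.mem_singleton_iff, Prod.mk.injEq] at h7
    omega
  subst hin
  refine ⟨_, ?_, h.extend (by omega) h0 h1 (by rw [hs, if_neg hi0])⟩
  simp only [show (0 : ℕ) ≠ n by omega, if_false]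
  exact hl

lemma exists_full (Q : ℕ → (ℕ → b.support) → Prop) {ε : ℤ} (hε : ε = 1 ∨ ε = 2)
    (hQ : ∀ n s, Q n s → Good b ε n s) (n0 : ℕ) (h0 : ∃ s, Q n0 s)
    (hstep : ∀ n ≥ n0, ∀ s, Q n s → (∃ x, ∀ i < n, x ≠ s i) → ∃ s', Q (n+1) s') :
    ∃ n ≥ n0, ∃ e : b.support ≃ Fin n, ∀ i j, P.pairingIn ℤ (e.symm i) (e.symm j) = cN ε i j := by
  have key : ∃ n ≥ n0, ∃ s, Q n s ∧ ∀ x, ∃ i < n, x = s i := by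
    by_contra hcon
    push Not at hcon
    have hall : ∀ k, ∃ s, Q (n0 + k) s := by
      intro k
      induction k with
      | zero => exact h0
      | succ k ih =>
        obtain ⟨s, hs⟩ := ih
        exact hstep (n0 + k) (by omega) s hs (hcon (n0 + k) (by omega) s hs)
    obtain ⟨s, hs⟩ := hall (Fintype.card b.support + 1)
    have hg := hQ _ _ hs
    have hinj : Function.Injective (fun i : Fin (n0 + (Fintype.card b.support + 1)) => s i) := by
      intro i j hij
      by_contra hne
      exact hg.ne hε i.2 j.2 (fun h => hne (Fin.ext h)) hij
    have := Fintype.card_le_of_injective _ hinj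
    rw [Fintype.card_fin] at this
    omega
  obtain ⟨n, hn, s, hs, hsur⟩ := key
  have hg := hQ _ _ hs
  have hbij : Function.Bijective (fun i : Fin n => s i) := by
    refine ⟨fun i j hij => ?_, fun x => ?_⟩
    · by_contra hne
      exact hg.ne hε i.2 j.2 (fun h => hne (Fin.ext h)) hij
    · obtain ⟨i, hi, e⟩ := hsur x
      exact ⟨⟨i, hi⟩, e.symm⟩
  exact ⟨n, hn, (Equiv.ofBijective _ hbij).symm, fun i j => hg i i.2 j j.2⟩

theorem classify (b : P.Base) [Nonempty ι] [P.IsIrreducible] (hK : HK P) :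
    ∃ n ≥ 1, ∃ e : b.support ≃ Fin n,
      (∀ i j, P.pairingIn ℤ (e.symm i) (e.symm j) = cN 1 i j) ∨
      (∀ i j, P.pairingIn ℤ (e.symm i) (e.symm j) = cN 2 i j) := by
  obtain ⟨l0, hl0⟩ := exists_long b
  by_cases hall : ∀ c : b.support, Long P c
  · obtain ⟨n, hn, e, he⟩ := exists_full (b := b) (Good b 1) (Or.inl rfl) (fun _ _ h => h) 1
      ⟨fun _ => l0, by
        intro i hi j hj
        rw [show i = 0 by omega, show j = 0 by omega, P.pairingIn_same]; rfl⟩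
      (fun n hn s hs hx => extendA hK hall hn hs hx)
    exact ⟨n, hn, e, Or.inl he⟩
  · have hadj : ∃ l a : b.support, Long P l ∧ ¬ Long P a ∧ P.pairingIn ℤ a l ≠ 0 := by
      by_contra hcon
      push Not at hcon
      apply hall
      intro c
      refine b.induction_on_cartanMatrix (fun y => Long P y) (i := l0) (j := c) hl0 ?_
      intro i j hi hj
      by_contra hno
      exact hj (hcon i j hi hno)
    obtain ⟨l, a, hl, ha, hal⟩ := hadj
    have hne : a ≠ l := by rintro rfl; exact ha hl
    have h1 : P.pairingIn ℤ a l = -1 ∧ P.pairingIn ℤ l a = -2 := by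
      have q1 := long_cases b hl hne
      have q2 : P.pairingIn ℤ a l = -1 := by omega
      have q3 := n1 b hK hl q2
      have q4 : P.pairingIn ℤ l a ≠ -1 := fun h => ha (long_of_adj b hl q2 h)
      omega
    obtain ⟨n, hn, e, he⟩ := exists_full (b := b) (fun n s => Long P (s 0) ∧ Good b 2 n s) (Or.inr rfl)
      (fun _ _ h => h.2) 2
      ⟨fun i => if i = 0 then l else a, by simpa using hl, by
        intro i hi j hj
        obtain rfl | rfl : i = 0 ∨ i = 1 := by omega
        · obtain rfl | rfl : j = 0 ∨ j = 1 := by omega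
          · simp [cN]
          · simp [cN, h1.2]
        · obtain rfl | rfl : j = 0 ∨ j = 1 := by omega
          · simp [cN, h1.1]
          · simp [cN]⟩
      (fun n hn s hs hx => extendC hK hn hs.1 hs.2 hx)
    exact ⟨n, by omega, e, Or.inr he⟩

end P2bpart

end Paper

namespace Paper
open Module
section Final
open LieAlgebra LieAlgebra.IsKilling

lemma nondeg_reindex {ι κ : Type*} [Fintype ι] [Fintype κ] (e : ι ≃ κ) (A : Matrix ι ι ℤ)
    (hA : A.Nondegenerate) : (A.reindex e e).Nondegenerate := by
  classical
  rw [Matrix.nondegenerate_iff_det_ne_zero] at hA ⊢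
  rwa [Matrix.det_reindex_self]

end Final

end Paper

namespace Paper
open scoped Classical
open Module
variable {L : Type*} [LieRing L] [LieAlgebra ℂ L]
/-- **Fernando.** A simple Lie algebra admitting a simple cuspidal
weight module is of type `A` or `C`. -/
theorem cuspidal_implies_typeA_or_typeC
    {L : Type*} [LieRing L] [LieAlgebra ℂ L] [FiniteDimensional ℂ L]
    [LieAlgebra.IsSimple ℂ L]
    (H : LieSubalgebra ℂ L) [H.IsCartanSubalgebra]
    (M : Type*) [AddCommGroup M] [Module ℂ M] [LieRingModule L M] [LieModule ℂ L M]
    [LieModule.IsIrreducible ℂ L M] (hM : IsWeightModule H M)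
    (hcusp : ∀ α : Module.Dual ℂ H, IsRoot H α → IsCuspidalRoot H M α) :
    IsTypeA L ∨ IsTypeC L := by
  have : LieAlgebra.IsKilling ℂ L := inferInstance
  have : (LieAlgebra.IsKilling.rootSystem H).IsIrreducible := inferInstance
  have : Nonempty H.root := by
    by_contra hne
    rw [not_nonempty_iff] at hne
    have h1 := RootPairing.IsRootSystem.span_root_eq_top (P := LieAlgebra.IsKilling.rootSystem H)
    rw [Set.range_eq_empty, Submodule.span_empty] at h1
    have : Nontrivial (Module.Dual ℂ H) :=
      RootPairing.IsIrreducible.nontrivial (P := LieAlgebra.IsKilling.rootSystem H)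
    exact bot_ne_top h1
  obtain ⟨b⟩ := RootPairing.nonempty_base (LieAlgebra.IsKilling.rootSystem H)
  obtain ⟨B, hB⟩ := exists_lieBasis b
  have hK : HK (LieAlgebra.IsKilling.rootSystem H) :=
    fun θ A s2 s3 D h1 h2 h3 h4 h5 h6 h7 h8 h9 h10 =>
      lemK hM hcusp h1 h2 h3 h4 h5 h6 h7 h8 h9 h10
  obtain ⟨n, hn, e, he | he⟩ := classify b hK
  · have hc : B.A.reindex e e = cA n := by
      ext i j
      rw [hB, Matrix.reindex_apply, Matrix.submatrix_apply, RootPairing.Base.cartanMatrix,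
        RootPairing.Base.cartanMatrixIn_def, he]
      simp only [cN, cA, Fin.ext_iff, ite_self]
    have hnd : (cA n).Nondegenerate := hc ▸ nondeg_reindex e _ B.nondegen
    have := sl_simple hn
    exact Or.inl ⟨n, ⟨LieAlgebra.Basis.equivOfReindex e B (slBasis hnd) hc⟩⟩
  · obtain ⟨m, rfl⟩ : ∃ m, n = m + 1 := ⟨n - 1, by omega⟩
    have hc : B.A.reindex e e = cC (m + 1) := by
      ext i j
      rw [hB, Matrix.reindex_apply, Matrix.submatrix_apply, RootPairing.Base.cartanMatrix,
        RootPairing.Base.cartanMatrixIn_def, he]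
      simp only [cN, cC, Fin.ext_iff]
    have hnd : (cC (m + 1)).Nondegenerate := hc ▸ nondeg_reindex e _ B.nondegen
    have := sp_simple (m := m)
    exact Or.inr ⟨m + 1, ⟨LieAlgebra.Basis.equivOfReindex e B (spBasis hnd) hc⟩⟩

end Paper
end

section
/- The category O_{S,θ} is closed under finite direct sums, submodules, and quotients: if M, N are objects of O_{S,θ} then so is M ⊕ N, and every g-submodule and every quotient of M again lies in O_{S,θ}. -/
namespace Paper

open scoped Classical

open Module

variable {L : Type*} [LieRing L] [LieAlgebra ℂ L]

/-- `W` is stable under the action of the Levi subalgebra `l_θ`. -/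
def lStable (H : LieSubalgebra ℂ L) (θ : Finset (Module.Dual ℂ H)) {M : Type*}
    [AddCommGroup M] [Module ℂ M] [LieRingModule L M] [LieModule ℂ L M]
    (W : Submodule ℂ M) : Prop :=
  ∀ x ∈ levi H θ, ∀ m ∈ W, ⁅x, m⁆ ∈ W

/-- `W` is a simple highest weight `l_θ`-submodule of `M`: it is a nonzero
`l_θ`-stable subspace with no proper nonzero `l_θ`-stable subspace, generated
over `l_θ` by a weight vector annihilated by all `g^α`, `α ∈ ⟨θ⟩⁺`. -/
def IsSimpleHW (H : LieSubalgebra ℂ L) (Δ θ : Finset (Module.Dual ℂ H)) {M : Type*}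
    [AddCommGroup M] [Module ℂ M] [LieRingModule L M] [LieModule ℂ L M]
    (W : Submodule ℂ M) : Prop :=
  W ≠ ⊥ ∧ lStable H θ W ∧
  (∀ W' : Submodule ℂ M, W' ≤ W → lStable H θ W' → W' = ⊥ ∨ W' = W) ∧
  ∃ (lam : Module.Dual ℂ H) (v : M), v ∈ W ∧ v ≠ 0 ∧ v ∈ wSpace H lam ∧
    (∀ α, InSpan H θ α → IsPos H Δ α → ∀ x ∈ gSpace H α, ⁅x, v⁆ = 0) ∧
    (∀ W' : Submodule ℂ M, lStable H θ W' → v ∈ W' → W ≤ W')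

/-- `M` is an object of the category `O_{S,θ}` : a weight module which
(O1) decomposes as a direct sum of simple highest weight `l_θ`-modules,
(O2) on which `X_α` acts injectively for every `α ∈ ⟨S - θ⟩`, and
(O3) which is `n⁺_S`-finite. -/
def InO (H : LieSubalgebra ℂ L) (Δ S θ : Finset (Module.Dual ℂ H)) (M : Type*)
    [AddCommGroup M] [Module ℂ M] [LieRingModule L M] [LieModule ℂ L M] : Prop :=
  IsWeightModule H M ∧
  (∃ (ι : Type) (f : ι → Submodule ℂ M),
      iSupIndep f ∧ (⨆ i, f i) = ⊤ ∧ ∀ i, IsSimpleHW H Δ θ (f i)) ∧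
  (∀ α, InSpan H (S \ θ) α → IsCuspidalRoot H M α) ∧
  (∀ m : M, ∃ Wf : Submodule ℂ M, m ∈ Wf ∧ FiniteDimensional ℂ Wf ∧
      ∀ x ∈ nPlus H Δ S, ∀ w ∈ Wf, ⁅x, w⁆ ∈ Wf)

instance prodBracket {M N : Type*} [AddCommGroup M] [Module ℂ M] [LieRingModule L M]
    [AddCommGroup N] [Module ℂ N] [LieRingModule L N] : Bracket L (M × N) :=
  ⟨fun x p => (⁅x, p.1⁆, ⁅x, p.2⁆)⟩

instance prodLieRingModule {M N : Type*} [AddCommGroup M] [Module ℂ M]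
    [LieRingModule L M] [AddCommGroup N] [Module ℂ N] [LieRingModule L N] :
    LieRingModule L (M × N) where
  bracket x p := ⁅x, p⁆
  add_lie x y p := Prod.ext (add_lie x y p.1) (add_lie x y p.2)
  lie_add x p q := Prod.ext (lie_add x p.1 q.1) (lie_add x p.2 q.2)
  leibniz_lie x y p := Prod.ext (leibniz_lie x y p.1) (leibniz_lie x y p.2)

instance prodLieModule {M N : Type*} [AddCommGroup M] [Module ℂ M] [LieRingModule L M]
    [LieModule ℂ L M] [AddCommGroup N] [Module ℂ N] [LieRingModule L N]
    [LieModule ℂ L N] : LieModule ℂ L (M × N) where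
  smul_lie t x p := Prod.ext (smul_lie t x p.1) (smul_lie t x p.2)
  lie_smul t x p := Prod.ext (lie_smul t x p.1) (lie_smul t x p.2)


section Noeth
variable {k : Type*} [Field k] {A : Type*} [Ring A] [Algebra k A]

/-- shifted filtration -/
def filG (V : Submodule k A) : ℕ → Submodule k A
  | 0 => ⊥
  | (d+1) => (1 ⊔ V) ^ d

theorem one_le_filF (V : Submodule k A) : (1 : Submodule k A) ≤ 1 ⊔ V := le_sup_left

theorem filF_mono (V : Submodule k A) {d e : ℕ} (h : d ≤ e) :
    (1 ⊔ V) ^ d ≤ (1 ⊔ V) ^ e :=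
  pow_le_pow_right₀ (one_le_filF V) h

theorem filG_mono (V : Submodule k A) {d e : ℕ} (h : d ≤ e) : filG V d ≤ filG V e := by
  cases d with
  | zero => exact bot_le
  | succ d =>
    cases e with
    | zero => omega
    | succ e => exact filF_mono V (by omega)

theorem filG_mul (V : Submodule k A) {d e : ℕ} {a b : A} (ha : a ∈ filG V d)
    (hb : b ∈ (1 ⊔ V) ^ e) : a * b ∈ filG V (d + e) := by
  cases d with
  | zero =>
    have : a = 0 := by simpa [filG] using ha
    subst this; simp
  | succ d =>
    rw [show d + 1 + e = (d + e) + 1 by omega]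
    change a * b ∈ (1 ⊔ V) ^ (d + e)
    rw [pow_add]; exact Submodule.mul_mem_mul ha hb

theorem filG_mul' (V : Submodule k A) {d e : ℕ} {a b : A} (ha : a ∈ (1 ⊔ V) ^ d)
    (hb : b ∈ filG V e) : a * b ∈ filG V (d + e) := by
  cases e with
  | zero =>
    have : b = 0 := by simpa [filG] using hb
    subst this; simp
  | succ e =>
    change a * b ∈ (1 ⊔ V) ^ (d + e)
    rw [pow_add]; exact Submodule.mul_mem_mul ha hb

variable {σ : Type*} (V : Submodule k A) (x : σ → A)

theorem word_mem (hx : ∀ i, x i ∈ V) (w : List σ) :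
    (w.map x).prod ∈ (1 ⊔ V) ^ w.length := by
  induction w with
  | nil => simpa using ⟨1, map_one (algebraMap k A)⟩
  | cons i w ih =>
    rw [List.map_cons, List.prod_cons, List.length_cons, pow_succ']
    exact Submodule.mul_mem_mul (Submodule.mem_sup_right (hx i)) ih

theorem word_perm (hx : ∀ i, x i ∈ V) (hV : ∀ a ∈ V, ∀ b ∈ V, a * b - b * a ∈ V)
    {w w' : List σ} (h : w.Perm w') :
    (w.map x).prod - (w'.map x).prod ∈ filG V w.length := by
  induction h with
  | nil => simp
  | cons i h ih =>
    rename_i l l'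
    simp only [List.map_cons, List.prod_cons, List.length_cons]
    rw [← mul_sub, add_comm]
    refine filG_mul' V (d := 1) ?_ ih
    rw [pow_one]; exact Submodule.mem_sup_right (hx i)
  | swap i j l =>
    simp only [List.map_cons, List.prod_cons, List.length_cons]
    rw [← mul_assoc, ← mul_assoc, ← sub_mul]
    rw [show l.length + 1 + 1 = 2 + l.length by omega]
    refine filG_mul V (d := 2) ?_ (word_mem V x hx l)
    change _ ∈ (1 ⊔ V) ^ 1
    rw [pow_one]
    exact Submodule.mem_sup_right (hV _ (hx _) _ (hx _))
  | trans h1 h2 ih1 ih2 =>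
    rw [h1.length_eq] at ih1 ⊢
    have := add_mem ih1 ih2
    simpa using this

/-- monomial -/
noncomputable def mono (s : σ →₀ ℕ) : A := ((Finsupp.toMultiset s).toList.map x).prod

/-- symbol splitting map -/
noncomputable def phi : MvPolynomial σ k →ₗ[k] A :=
  (MvPolynomial.basisMonomials σ k).constr k (mono x)

theorem phi_monomial (s : σ →₀ ℕ) (c : k) :
    phi (k := k) x (MvPolynomial.monomial s c) = c • mono x s := by
  have : MvPolynomial.monomial s c = c • (MvPolynomial.basisMonomials σ k) s := by
    simp [MvPolynomial.smul_monomial]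
  rw [this, map_smul, phi, Module.Basis.constr_basis]

theorem len_toList (s : σ →₀ ℕ) : (Finsupp.toMultiset s).toList.length = s.degree := by
  simp [Finsupp.card_toMultiset, Finsupp.degree, Finsupp.sum]
  rfl

theorem mono_mem (hx : ∀ i, x i ∈ V) (s : σ →₀ ℕ) :
    mono x s ∈ (1 ⊔ V) ^ s.degree := by
  rw [← len_toList]; exact word_mem V x hx _

theorem mono_mul (hx : ∀ i, x i ∈ V) (hV : ∀ a ∈ V, ∀ b ∈ V, a * b - b * a ∈ V)
    (s t : σ →₀ ℕ) :
    mono x s * mono x t - mono x (s + t) ∈ filG V (s.degree + t.degree) := by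
  unfold mono
  rw [← List.prod_append, ← List.map_append, ← len_toList, ← len_toList, ← List.length_append]
  apply word_perm V x hx hV
  rw [← Multiset.coe_eq_coe, ← Multiset.coe_add]
  simp

theorem phi_mem (hx : ∀ i, x i ∈ V) {p : MvPolynomial σ k} {d : ℕ}
    (hp : p.IsHomogeneous d) : phi x p ∈ (1 ⊔ V) ^ d := by
  rw [p.as_sum, map_sum]
  refine sum_mem fun s hs => ?_
  rw [phi_monomial]
  have : s.degree = d := by
    have := hp (MvPolynomial.mem_support_iff.1 hs)
    rwa [Finsupp.degree_eq_weight_one]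
  rw [← this]
  exact Submodule.smul_mem _ _ (mono_mem V x hx s)

theorem phi_mul (hx : ∀ i, x i ∈ V) (hV : ∀ a ∈ V, ∀ b ∈ V, a * b - b * a ∈ V)
    {p q : MvPolynomial σ k} {d e : ℕ}
    (hp : p.IsHomogeneous d) (hq : q.IsHomogeneous e) :
    phi x p * phi x q - phi x (p * q) ∈ filG V (d + e) := by
  have key : phi x p * phi x q - phi x (p * q) = ∑ s ∈ p.support, ∑ t ∈ q.support,
      (p.coeff s * q.coeff t) • (mono x s * mono x t - mono x (s + t)) := by
    conv_lhs => rw [p.as_sum, q.as_sum]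
    simp only [map_sum, Finset.sum_mul_sum, ← Finset.sum_sub_distrib,
      MvPolynomial.monomial_mul, phi_monomial, smul_mul_smul_comm, ← smul_sub]
  rw [key]
  refine sum_mem fun s hs => sum_mem fun t ht => Submodule.smul_mem _ _ ?_
  have h1 : s.degree = d := by
    have := hp (MvPolynomial.mem_support_iff.1 hs)
    rwa [Finsupp.degree_eq_weight_one]
  have h2 : t.degree = e := by
    have := hq (MvPolynomial.mem_support_iff.1 ht)
    rwa [Finsupp.degree_eq_weight_one]
  rw [← h1, ← h2]
  exact mono_mul V x hx hV s t

theorem fil_decomp (hx : ∀ i, x i ∈ V) (hV : ∀ a ∈ V, ∀ b ∈ V, a * b - b * a ∈ V)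
    (hs : V ≤ Submodule.span k (Set.range x)) (d : ℕ) (a : A) (ha : a ∈ (1 ⊔ V) ^ d) :
    ∃ p : MvPolynomial σ k, p.IsHomogeneous d ∧ a - phi x p ∈ filG V d := by
  induction d generalizing a with
  | zero =>
    rw [pow_zero, Submodule.mem_one] at ha
    obtain ⟨c, rfl⟩ := ha
    refine ⟨MvPolynomial.monomial 0 c, MvPolynomial.isHomogeneous_monomial _ (by simp), ?_⟩
    rw [phi_monomial]
    simp [mono, Algebra.algebraMap_eq_smul_one]
  | succ d ih =>
    rw [pow_succ] at ha
    induction ha using Submodule.mul_induction_on' with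
    | mem_mul_mem a ha f hf =>
      obtain ⟨u, hu, v, hv, rfl⟩ := Submodule.mem_sup.1 hf
      obtain ⟨c, rfl⟩ := Submodule.mem_one.1 hu
      obtain ⟨p, hp, hpa⟩ := ih a ha
      have hq : ∃ q : MvPolynomial σ k, q.IsHomogeneous 1 ∧ phi x q = v := by
        have := hs hv
        clear hv hf
        induction this using Submodule.span_induction with
        | mem v hv =>
          obtain ⟨i, rfl⟩ := hv
          refine ⟨MvPolynomial.X i, MvPolynomial.isHomogeneous_X _ _, ?_⟩
          rw [MvPolynomial.X, phi_monomial]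
          simp [mono]
        | zero => exact ⟨0, MvPolynomial.isHomogeneous_zero _ _ _, by simp⟩
        | add v w _ _ h1 h2 =>
          obtain ⟨q, hq, rfl⟩ := h1
          obtain ⟨r, hr, rfl⟩ := h2
          exact ⟨q + r, hq.add hr, by simp⟩
        | smul c v _ h1 =>
          obtain ⟨q, hq, rfl⟩ := h1
          exact ⟨c • q, (MvPolynomial.homogeneousSubmodule σ k 1).smul_mem c hq, by simp⟩
      obtain ⟨q, hq, rfl⟩ := hq
      refine ⟨p * q, hp.mul hq, ?_⟩
      have e : a * (algebraMap k A c + phi x q) - phi x (p * q)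
          = c • a + (a - phi x p) * phi x q + (phi x p * phi x q - phi x (p * q)) := by
        rw [mul_add, ← Algebra.commutes, ← Algebra.smul_def, sub_mul]; abel
      rw [e]
      refine add_mem (add_mem ?_ ?_) (phi_mul V x hx hV hp hq)
      · exact Submodule.smul_mem _ _ ha
      · refine filG_mul V hpa ?_
        rw [pow_one]; exact Submodule.mem_sup_right hv
    | add a _ b _ h1 h2 =>
      obtain ⟨q, hq, h1⟩ := h1
      obtain ⟨r, hr, h2⟩ := h2
      refine ⟨q + r, hq.add hr, ?_⟩
      have := add_mem h1 h2
      rwa [map_add, add_sub_add_comm]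

theorem noeth_of_gen [Finite σ] (hx : ∀ i, x i ∈ V)
    (hV : ∀ a ∈ V, ∀ b ∈ V, a * b - b * a ∈ V)
    (hs : V ≤ Submodule.span k (Set.range x))
    (hgen : Algebra.adjoin k (V : Set A) = ⊤) : IsNoetherianRing A := by
  have hex : ∀ a : A, ∃ d, a ∈ filG V d := by
    suffices h : ∀ a : A, ∃ d, a ∈ (1 ⊔ V) ^ d by
      intro a; obtain ⟨d, hd⟩ := h a; exact ⟨d + 1, hd⟩
    intro a
    have ha : a ∈ Algebra.adjoin k (V : Set A) := hgen ▸ Algebra.mem_top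
    induction ha using Algebra.adjoin_induction with
    | mem v hv => exact ⟨1, by rw [pow_one]; exact Submodule.mem_sup_right hv⟩
    | algebraMap c => exact ⟨0, by rw [pow_zero]; exact Submodule.mem_one.2 ⟨c, rfl⟩⟩
    | add a b _ _ h1 h2 =>
      obtain ⟨d, hd⟩ := h1
      obtain ⟨e, he⟩ := h2
      exact ⟨d + e, add_mem (filF_mono V (by omega) hd) (filF_mono V (by omega) he)⟩
    | mul a b _ _ h1 h2 =>
      obtain ⟨d, hd⟩ := h1
      obtain ⟨e, he⟩ := h2
      exact ⟨d + e, by rw [pow_add]; exact Submodule.mul_mem_mul hd he⟩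
  rw [isNoetherianRing_iff_ideal_fg]
  intro I
  let T : Set (MvPolynomial σ k) :=
    {p | ∃ d, p.IsHomogeneous d ∧ ∃ a ∈ I, a - phi x p ∈ filG V d}
  have hfg : (Submodule.span (MvPolynomial σ k) T).FG := IsNoetherian.noetherian _
  obtain ⟨T', hT', hspan⟩ := (Submodule.fg_span_iff_fg_span_finset_subset T).1 hfg
  have hch : ∀ t : T', ∃ d, (t : MvPolynomial σ k).IsHomogeneous d ∧
      ∃ a ∈ I, a - phi x (t : MvPolynomial σ k) ∈ filG V d := fun t => hT' t.2
  choose e he a haI ha using hch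
  let N : Ideal A := Ideal.span (Set.range a)
  have hNI : N ≤ I := Ideal.span_le.2 (by rintro _ ⟨t, rfl⟩; exact haI t)
  have hmain : ∀ p ∈ Submodule.span (MvPolynomial σ k) T, ∀ d,
      ∃ n ∈ N, phi x (MvPolynomial.homogeneousComponent d p) - n ∈ filG V d := by
    intro p hp d
    let Q : Submodule k A := N.restrictScalars k ⊔ filG V d
    suffices h : phi x (MvPolynomial.homogeneousComponent d p) ∈ Q by
      obtain ⟨n, hn, g, hg, h⟩ := Submodule.mem_sup.1 h
      exact ⟨n, hn, by rw [← h]; simpa using hg⟩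
    rw [hspan] at hp
    obtain ⟨f, -, rfl⟩ := Submodule.mem_span_finset.1 hp
    simp only [map_sum]
    refine sum_mem fun t ht => ?_
    rw [(f t).as_sum]
    simp only [smul_eq_mul, Finset.sum_mul, map_sum]
    refine sum_mem fun s _ => ?_
    have hm : (MvPolynomial.monomial s (MvPolynomial.coeff s (f t))).IsHomogeneous s.degree :=
      MvPolynomial.isHomogeneous_monomial _ rfl
    have hh := hm.mul (he ⟨t, ht⟩)
    rw [MvPolynomial.homogeneousComponent_of_mem hh]
    split_ifs with hd
    · have h1 := phi_mul V x hx hV hm (he ⟨t, ht⟩)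
      have h2 := filG_mul' V (phi_mem V x hx hm) (ha ⟨t, ht⟩)
      rw [← hd] at h1 h2
      have h3 : phi x (MvPolynomial.monomial s (MvPolynomial.coeff s (f t))) * a ⟨t, ht⟩ ∈ N :=
        N.mul_mem_left _ (Ideal.subset_span ⟨_, rfl⟩)
      refine Submodule.mem_sup.2 ⟨_, h3, _, neg_mem (add_mem h1 h2), ?_⟩
      rw [mul_sub]; abel
    · simp
  have hle : ∀ d, ∀ b ∈ I, b ∈ filG V d → b ∈ N := by
    intro d
    induction d with
    | zero =>
      intro b _ hb
      have : b = 0 := by simpa [filG] using hb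
      rw [this]; exact N.zero_mem
    | succ d ih =>
      intro b hbI hb
      obtain ⟨p, hp, hpb⟩ := fil_decomp V x hx hV hs d b hb
      obtain ⟨n, hn, hpn⟩ := hmain p (Submodule.subset_span ⟨d, hp, b, hbI, hpb⟩) d
      rw [MvPolynomial.homogeneousComponent_of_mem hp, if_pos rfl] at hpn
      have h1 : b - n ∈ filG V d := by
        have := add_mem hpb hpn
        simpa using this
      have h2 := ih _ (I.sub_mem hbI (hNI hn)) h1
      have := N.add_mem h2 hn
      simpa using this
  have : I = N := le_antisymm (fun b hb => by
    obtain ⟨d, hd⟩ := hex b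
    exact hle d b hb hd) hNI
  rw [this]
  exact ⟨Finset.univ.image a, by simp [N, Ideal.span]⟩

end Noeth

section NoethLie
variable {L : Type*} [LieRing L] [LieAlgebra ℂ L] [FiniteDimensional ℂ L]
  {M : Type*} [AddCommGroup M] [Module ℂ M] [LieRingModule L M] [LieModule ℂ L M]

/-- the associative algebra generated by the action -/
def actAlg (L M : Type*) [LieRing L] [LieAlgebra ℂ L] [AddCommGroup M] [Module ℂ M]
    [LieRingModule L M] [LieModule ℂ L M] : Subalgebra ℂ (Module.End ℂ M) :=
  Algebra.adjoin ℂ (Set.range (LieModule.toEnd ℂ L M))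

theorem actAlg_noeth : IsNoetherianRing (actAlg L M) := by
  let g : L →ₗ[ℂ] actAlg L M :=
    LinearMap.codRestrict (Subalgebra.toSubmodule (actAlg L M))
      (LieModule.toEnd ℂ L M : L →ₗ[ℂ] Module.End ℂ M)
      (fun y => Algebra.subset_adjoin ⟨y, rfl⟩)
  have hg : ∀ y, ((g y : actAlg L M) : Module.End ℂ M) = LieModule.toEnd ℂ L M y := fun y => rfl
  let b := Module.finBasis ℂ L
  refine noeth_of_gen (k := ℂ) (LinearMap.range g) (fun i => g (b i)) (fun i => ⟨_, rfl⟩) ?_ ?_ ?_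
  · rintro _ ⟨y, rfl⟩ _ ⟨z, rfl⟩
    refine ⟨⁅y, z⁆, Subtype.ext ?_⟩
    ext m
    exact lie_lie y z m
  · rw [show (fun i => g (b i)) = g ∘ b from rfl, Set.range_comp, ← Submodule.map_span,
      b.span_eq, LinearMap.range_eq_map]
  · have := Algebra.adjoin_adjoin_coe_preimage (R := ℂ) (s := Set.range (LieModule.toEnd ℂ L M))
    have e : ((LinearMap.range g : Submodule ℂ (actAlg L M)) : Set (actAlg L M)) =
        Subtype.val ⁻¹' (Set.range (LieModule.toEnd ℂ L M)) := by
      ext a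
      constructor
      · rintro ⟨y, rfl⟩; exact ⟨y, rfl⟩
      · rintro ⟨y, hy⟩; exact ⟨y, Subtype.ext hy⟩
    rw [e]
    exact this

/-- a Lie submodule as submodule over the action algebra -/
def toActSub (W : LieSubmodule ℂ L M) : Submodule (actAlg L M) M where
  carrier := W
  add_mem' := fun h1 h2 => W.add_mem h1 h2
  zero_mem' := W.zero_mem
  smul_mem' := by
    rintro ⟨a, ha⟩
    change ∀ m ∈ W, a m ∈ W
    change a ∈ Algebra.adjoin ℂ _ at ha
    induction ha using Algebra.adjoin_induction with
    | mem v hv =>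
      obtain ⟨y, rfl⟩ := hv
      exact fun m hm => W.lie_mem hm
    | algebraMap c => exact fun m hm => W.smul_mem c hm
    | add a b _ _ h1 h2 => exact fun m hm => W.add_mem (h1 m hm) (h2 m hm)
    | mul a b _ _ h1 h2 => exact fun m hm => h1 _ (h2 m hm)

theorem fg_sub (hM : ∃ s : Finset M, LieSubmodule.lieSpan ℂ L (s : Set M) = ⊤)
    (W : LieSubmodule ℂ L M) :
    ∃ s : Finset W, LieSubmodule.lieSpan ℂ L (s : Set W) = ⊤ := by
  have : IsNoetherianRing (actAlg L M) := actAlg_noeth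
  obtain ⟨s, hs⟩ := hM
  have hfin : Module.Finite (actAlg L M) M := by
    refine ⟨⟨s, ?_⟩⟩
    let K : LieSubmodule ℂ L M :=
      { (Submodule.span (actAlg L M) (s : Set M)).restrictScalars ℂ with
        lie_mem := by
          intro y m hm
          exact (Submodule.span (actAlg L M) (s : Set M)).smul_mem
            ⟨LieModule.toEnd ℂ L M y, Algebra.subset_adjoin ⟨y, rfl⟩⟩ hm }
    have hK : LieSubmodule.lieSpan ℂ L (s : Set M) ≤ K :=
      LieSubmodule.lieSpan_le.2 (fun m hm => Submodule.subset_span hm)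
    rw [hs] at hK
    exact eq_top_iff.2 fun m _ => hK (LieSubmodule.mem_top m)
  have : IsNoetherian (actAlg L M) M := isNoetherian_of_isNoetherianRing_of_finite _ _
  obtain ⟨t, ht⟩ := (IsNoetherian.noetherian (toActSub W) : (toActSub W).FG)
  have htW : ∀ m ∈ t, m ∈ W := fun m hm => by
    have : m ∈ toActSub W := ht ▸ Submodule.subset_span hm
    exact this
  refine ⟨t.attach.image (fun m => ⟨m.1, htW m.1 m.2⟩), ?_⟩
  set t' : Finset W := t.attach.image (fun m => ⟨m.1, htW m.1 m.2⟩)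
  let K := (LieSubmodule.lieSpan ℂ L (t' : Set W)).map W.incl
  have h1 : toActSub W ≤ toActSub K := by
    rw [← ht, Submodule.span_le]
    intro m hm
    refine ⟨⟨m, htW m hm⟩, LieSubmodule.subset_lieSpan ?_, rfl⟩
    simp only [t', Finset.coe_image, Set.mem_image]
    exact ⟨⟨m, hm⟩, by simp, rfl⟩
  refine eq_top_iff.2 ?_
  rintro ⟨m, hm⟩ -
  obtain ⟨u, hu, hum⟩ := h1 (show m ∈ toActSub W from hm)
  have : u = ⟨m, hm⟩ := Subtype.ext hum
  exact this ▸ hu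
end NoethLie

section Wt
variable {L : Type*} [LieRing L] [LieAlgebra ℂ L]
  {M : Type*} [AddCommGroup M] [Module ℂ M] [LieRingModule L M] [LieModule ℂ L M]
  (H : LieSubalgebra ℂ L)

theorem mem_wSpace {α : Module.Dual ℂ H} {m : M} :
    m ∈ wSpace H α ↔ ∀ h : H, ⁅(h : L), m⁆ = α h • m := Iff.rfl

theorem lie_mem_wSpace {α μ : Module.Dual ℂ H} {x : L} {m : M} (hx : x ∈ gSpace H α)
    (hm : m ∈ wSpace H μ) : ⁅x, m⁆ ∈ wSpace H (M := M) (μ + α) := by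
  intro h
  have h1 : ⁅(h : L), x⁆ = α h • x := hx h
  rw [leibniz_lie, h1, hm h, smul_lie, lie_smul, LinearMap.add_apply, add_smul, add_comm]

theorem wt_sep (W : LieSubmodule ℂ L M) {ι : Type*} (wt : ι → Module.Dual ℂ H)
    (hwt : Function.Injective wt) (s : Finset ι) (m : ι → M)
    (hm : ∀ i ∈ s, m i ∈ wSpace H (wt i)) (hs : ∑ i ∈ s, m i ∈ W) : ∀ i ∈ s, m i ∈ W := by
  induction s using Finset.induction_on generalizing m with
  | empty => simp
  | insert j s hj ih =>
    have h1 : ∀ i ∈ s, m i ∈ W := by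
      intro i hi
      have hne : wt i ≠ wt j := fun h => hj (hwt h ▸ hi)
      obtain ⟨h, hh⟩ : ∃ h, wt i h ≠ wt j h := by
        by_contra hc; push Not at hc; exact hne (LinearMap.ext hc)
      have := ih (fun i => (wt i h - wt j h) • m i)
        (fun i hi => Submodule.smul_mem _ _ (hm i (Finset.mem_insert_of_mem hi))) (by
          have e : ∑ i ∈ s, (wt i h - wt j h) • m i
              = ⁅(h : L), ∑ i ∈ insert j s, m i⁆ - wt j h • ∑ i ∈ insert j s, m i := by
            rw [lie_sum, Finset.smul_sum, ← Finset.sum_sub_distrib, Finset.sum_insert hj]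
            rw [hm j (Finset.mem_insert_self _ _) h, sub_self, zero_add]
            refine Finset.sum_congr rfl fun i hi => ?_
            rw [hm i (Finset.mem_insert_of_mem hi) h, sub_smul]
          rw [e]
          exact W.sub_mem (W.lie_mem hs) (W.smul_mem _ hs)) i hi
      have h2 := W.smul_mem (wt i h - wt j h)⁻¹ this
      rwa [smul_smul, inv_mul_cancel₀ (sub_ne_zero.2 hh), one_smul] at h2
    intro i hi
    rcases Finset.mem_insert.1 hi with rfl | hi
    · rw [Finset.sum_insert hj] at hs
      have := W.sub_mem hs (Submodule.sum_mem W.toSubmodule h1)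
      simpa using this
    · exact h1 i hi

theorem wt_decomp (htop : (⨆ α : Module.Dual ℂ H, wSpace H (M := M) α) = ⊤) (m : M) :
    ∃ (s : Finset (Module.Dual ℂ H)) (u : Module.Dual ℂ H → M),
      (∀ α, u α ∈ wSpace H α) ∧ ∑ α ∈ s, u α = m := by
  have hm : m ∈ ⨆ α : Module.Dual ℂ H, wSpace H (M := M) α := htop ▸ Submodule.mem_top
  obtain ⟨f, hf, rfl⟩ := (Submodule.mem_iSup_iff_exists_finsupp _ _).1 hm
  exact ⟨f.support, f, hf, rfl⟩

theorem finrank_wt_le (W : LieSubmodule ℂ L M)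
    (hfd : ∀ α : Module.Dual ℂ H, FiniteDimensional ℂ (wSpace H (M := M) α))
    {α : Module.Dual ℂ H} {x : L} (hx : x ∈ gSpace H α)
    (hinj : Function.Injective (LieModule.toEnd ℂ L M x)) (μ : Module.Dual ℂ H) :
    Module.finrank ℂ (W.toSubmodule ⊓ wSpace H μ : Submodule ℂ M) ≤
      Module.finrank ℂ (W.toSubmodule ⊓ wSpace H (μ + α) : Submodule ℂ M) := by
  have := hfd (μ + α)
  have : FiniteDimensional ℂ (W.toSubmodule ⊓ wSpace H (μ + α) : Submodule ℂ M) :=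
    Submodule.finiteDimensional_inf_right _ _
  have hmap : ∀ m ∈ (W.toSubmodule ⊓ wSpace H μ : Submodule ℂ M),
      LieModule.toEnd ℂ L M x m ∈ (W.toSubmodule ⊓ wSpace H (μ + α) : Submodule ℂ M) :=
    fun m hm => ⟨W.lie_mem hm.1, lie_mem_wSpace H hx hm.2⟩
  refine LinearMap.finrank_le_finrank_of_injective
    (f := (LieModule.toEnd ℂ L M x).restrict hmap) ?_
  intro a b hab
  exact Subtype.ext (hinj (congrArg Subtype.val hab))

theorem wt_surj (W : LieSubmodule ℂ L M)
    (hfd : ∀ α : Module.Dual ℂ H, FiniteDimensional ℂ (wSpace H (M := M) α))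
    {α : Module.Dual ℂ H} {x y : L} (hx : x ∈ gSpace H α) (hy : y ∈ gSpace H (-α))
    (hxi : Function.Injective (LieModule.toEnd ℂ L M x))
    (hyi : Function.Injective (LieModule.toEnd ℂ L M y)) (μ : Module.Dual ℂ H)
    (w : M) (hw : w ∈ W) (hwμ : w ∈ wSpace H (μ + α)) : ∃ v ∈ W, ⁅x, v⁆ = w := by
  have h1 := finrank_wt_le H W hfd hx hxi μ
  have h2 := finrank_wt_le H W hfd hy hyi (μ + α)
  rw [add_neg_cancel_right] at h2
  have heq := le_antisymm h1 h2
  have := hfd (μ + α)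
  have := hfd μ
  have : FiniteDimensional ℂ (W.toSubmodule ⊓ wSpace H (μ + α) : Submodule ℂ M) :=
    Submodule.finiteDimensional_inf_right _ _
  have : FiniteDimensional ℂ (W.toSubmodule ⊓ wSpace H μ : Submodule ℂ M) :=
    Submodule.finiteDimensional_inf_right _ _
  have hmap : ∀ m ∈ (W.toSubmodule ⊓ wSpace H μ : Submodule ℂ M),
      LieModule.toEnd ℂ L M x m ∈ (W.toSubmodule ⊓ wSpace H (μ + α) : Submodule ℂ M) :=
    fun m hm => ⟨W.lie_mem hm.1, lie_mem_wSpace H hx hm.2⟩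
  have hinj : Function.Injective ((LieModule.toEnd ℂ L M x).restrict hmap) :=
    fun a b hab => Subtype.ext (hxi (congrArg Subtype.val hab))
  have hsurj := (LinearMap.injective_iff_surjective_of_finrank_eq_finrank heq).1 hinj
  obtain ⟨v, hv⟩ := hsurj ⟨w, hw, hwμ⟩
  exact ⟨v.1, v.2.1, congrArg Subtype.val hv⟩

theorem neg_root [FiniteDimensional ℂ L] [LieAlgebra.IsSimple ℂ L] [H.IsCartanSubalgebra]
    {α : Module.Dual ℂ H} (hα : gSpace H α ≠ ⊥) : ∃ y ∈ gSpace H (-α), y ≠ 0 := by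
  obtain ⟨x, hx, hx0⟩ := Submodule.exists_mem_ne_zero_of_ne_bot hα
  have hx' : x ∈ LieAlgebra.rootSpace H α := by
    apply LieModule.weightSpace_le_genWeightSpace L (α : H → ℂ)
    rw [LieModule.mem_weightSpace]
    exact hx
  let w : LieModule.Weight ℂ H L := ⟨α, fun h => hx0 ((LieSubmodule.mem_bot x).1 (h.le hx'))⟩
  obtain ⟨y, hy, hy0⟩ := (-w).exists_ne_zero
  refine ⟨y, fun h => ?_, hy0⟩
  have := LieAlgebra.IsKilling.lie_eq_smul_of_mem_rootSpace hy h
  rw [LieModule.Weight.coe_neg] at this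
  exact this

theorem neg_inSpan [FiniteDimensional ℂ L] [LieAlgebra.IsSimple ℂ L] [H.IsCartanSubalgebra]
    {T : Finset (Module.Dual ℂ H)} {α : Module.Dual ℂ H} (hα : InSpan H T α) :
    InSpan H T (-α) := by
  obtain ⟨⟨h0, h1⟩, c, hc⟩ := hα
  refine ⟨⟨neg_ne_zero.2 h0, ?_⟩, fun β => - c β, ?_⟩
  · obtain ⟨y, hy, hy0⟩ := neg_root H h1
    exact fun h => hy0 (by rw [h] at hy; simpa using hy)
  · rw [hc, ← Finset.sum_neg_distrib]
    simp
end Wt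

section O1
variable {L : Type*} [LieRing L] [LieAlgebra ℂ L]
  {M : Type*} [AddCommGroup M] [Module ℂ M] [LieRingModule L M] [LieModule ℂ L M]
  {Q : Type*} [AddCommGroup Q] [Module ℂ Q] [LieRingModule L Q] [LieModule ℂ L Q]
  (H : LieSubalgebra ℂ L) {Δ θ : Finset (Module.Dual ℂ H)}

theorem H_le_levi (h : H) : (h : L) ∈ levi H θ := Submodule.mem_sup_left h.2

theorem gSpace_le_levi {α : Module.Dual ℂ H} (hα : InSpan H θ α) {x : L}
    (hx : x ∈ gSpace H α) : x ∈ levi H θ :=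
  Submodule.mem_sup_right (Submodule.mem_iSup_of_mem α (Submodule.mem_iSup_of_mem hα hx))

theorem simpleHW_map (e : M →ₗ[ℂ] Q) (heq : ∀ x ∈ levi H θ, ∀ m, e ⁅x, m⁆ = ⁅x, e m⁆)
    (W : Submodule ℂ M) (hinj : ∀ m ∈ W, e m = 0 → m = 0) (hW : IsSimpleHW H Δ θ W) :
    IsSimpleHW H Δ θ (W.map e) := by
  obtain ⟨h0, hst, hsimp, lam, v, hvW, hv0, hvw, hvann, hvgen⟩ := hW
  have hcomap : ∀ W' : Submodule ℂ Q, lStable H θ W' → lStable H θ (W'.comap e) := by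
    intro W' hW' x hx m hm
    change e ⁅x, m⁆ ∈ W'
    rw [heq x hx]
    exact hW' x hx _ hm
  refine ⟨?_, ?_, ?_, lam, e v, ⟨v, hvW, rfl⟩, fun h => hv0 (hinj v hvW h), ?_, ?_, ?_⟩
  · intro h
    have : e v ∈ W.map e := ⟨v, hvW, rfl⟩
    rw [h, Submodule.mem_bot] at this
    exact hv0 (hinj v hvW this)
  · rintro x hx _ ⟨m, hm, rfl⟩
    exact ⟨⁅x, m⁆, hst x hx m hm, heq x hx m⟩
  · intro W' hle hW'
    rcases hsimp (W'.comap e ⊓ W) inf_le_right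
      (fun x hx m hm => ⟨hcomap W' hW' x hx m hm.1, hst x hx m hm.2⟩) with h | h
    · left
      refine (Submodule.eq_bot_iff _).2 fun q hq => ?_
      obtain ⟨m, hm, rfl⟩ := hle hq
      have : m ∈ W'.comap e ⊓ W := ⟨hq, hm⟩
      rw [h, Submodule.mem_bot] at this
      rw [this, map_zero]
    · right
      refine le_antisymm hle ?_
      rintro _ ⟨m, hm, rfl⟩
      have : m ∈ W'.comap e ⊓ W := by rw [h]; exact hm
      exact this.1
  · intro h
    rw [← heq _ (H_le_levi H h), hvw h, map_smul]
  · intro α hα hp x hx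
    rw [← heq _ (gSpace_le_levi H hα hx), hvann α hα hp x hx, map_zero]
  · intro W' hW' hv
    exact Submodule.map_le_iff_le_comap.2 (hvgen _ (hcomap W' hW') hv)

theorem lStable_sup {K K' : Submodule ℂ M} (h : lStable H θ K) (h' : lStable H θ K') :
    lStable H θ (K ⊔ K') := by
  intro x hx m hm
  obtain ⟨a, ha, b, hb, rfl⟩ := Submodule.mem_sup.1 hm
  rw [lie_add]
  exact Submodule.add_mem_sup (h x hx a ha) (h' x hx b hb)

theorem lStable_iSup {ι : Sort*} {f : ι → Submodule ℂ M} (h : ∀ i, lStable H θ (f i)) :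
    lStable H θ (⨆ i, f i) := by
  intro x hx m hm
  have : (⨆ i, f i) ≤ (⨆ i, f i).comap (LieModule.toEnd ℂ L M x) :=
    iSup_le fun i m hm => Submodule.mem_iSup_of_mem i (h i x hx m hm)
  exact this hm

theorem exists_compl {ι : Type*} (f : ι → Submodule ℂ M) (htop : (⨆ i, f i) = ⊤)
    (hf : ∀ i, IsSimpleHW H Δ θ (f i)) (K : Submodule ℂ M) (hK : lStable H θ K) :
    ∃ J : Set ι, IsCompl K (⨆ j ∈ J, f j) := by
  obtain ⟨J, hJ⟩ := zorn_subset {J : Set ι | Disjoint K (⨆ j ∈ J, f j)} (by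
    intro c hc hchain
    refine ⟨⋃₀ c, ?_, fun s hs => Set.subset_sUnion_of_mem hs⟩
    change Disjoint K _
    have e : (⨆ j ∈ ⋃₀ c, f j) = ⨆ s : c, ⨆ j ∈ s.1, f j := by
      apply le_antisymm
      · refine iSup₂_le fun j hj => ?_
        obtain ⟨s, hs, hjs⟩ := hj
        exact le_iSup_of_le ⟨s, hs⟩ (le_iSup₂_of_le j hjs le_rfl)
      · exact iSup_le fun s => iSup₂_le fun j hj => le_iSup₂_of_le j ⟨s.1, s.2, hj⟩ le_rfl
    rw [e]
    have hdir : Directed (· ≤ ·) (fun s : c => ⨆ j ∈ s.1, f j) := by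
      intro s t
      rcases hchain.total s.2 t.2 with h | h
      · exact ⟨t, biSup_mono h, le_rfl⟩
      · exact ⟨s, le_rfl, biSup_mono h⟩
    rw [hdir.disjoint_iSup_right]
    exact fun s => hc s.2)
  have hdis : Disjoint K (⨆ j ∈ J, f j) := hJ.prop
  refine ⟨J, hdis, codisjoint_iff.2 ?_⟩
  rw [← top_le_iff, ← htop]
  refine iSup_le fun i => ?_
  have hst : lStable H θ (K ⊔ ⨆ j ∈ J, f j) :=
    lStable_sup H hK (lStable_iSup H fun j => lStable_iSup H fun _ => (hf j).2.1)
  rcases (hf i).2.2.1 (f i ⊓ (K ⊔ ⨆ j ∈ J, f j)) inf_le_left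
    (fun x hx m hm => ⟨(hf i).2.1 x hx m hm.1, hst x hx m hm.2⟩) with h | h
  · have hins : Disjoint K (⨆ j ∈ insert i J, f j) := by
      rw [iSup_insert, sup_comm]
      exact hdis.disjoint_sup_right_of_disjoint_sup_left (disjoint_iff.2 (by rwa [inf_comm]))
    have hi : i ∈ J := hJ.le_of_ge hins (Set.subset_insert i J) (Set.mem_insert i J)
    exact le_sup_of_le_right (le_iSup₂_of_le i hi le_rfl)
  · exact inf_eq_left.1 h

theorem O1_map (e : M →ₗ[ℂ] Q) (heq : ∀ x ∈ levi H θ, ∀ m, e ⁅x, m⁆ = ⁅x, e m⁆)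
    (hsurj : Function.Surjective e)
    (hM : ∃ (ι : Type) (f : ι → Submodule ℂ M),
      iSupIndep f ∧ (⨆ i, f i) = ⊤ ∧ ∀ i, IsSimpleHW H Δ θ (f i)) :
    ∃ (ι : Type) (f : ι → Submodule ℂ Q),
      iSupIndep f ∧ (⨆ i, f i) = ⊤ ∧ ∀ i, IsSimpleHW H Δ θ (f i) := by
  obtain ⟨ι, f, hind, htop, hf⟩ := hM
  have hker : lStable H θ (LinearMap.ker e) := by
    intro x hx m hm
    rw [LinearMap.mem_ker] at hm ⊢
    rw [heq x hx, hm, lie_zero]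
  obtain ⟨J, hJ⟩ := exists_compl H f htop hf (LinearMap.ker e) hker
  have hinj : ∀ m ∈ ⨆ j ∈ J, f j, e m = 0 → m = 0 := fun m hm h0 =>
    Submodule.disjoint_def.1 hJ.disjoint m h0 hm
  have hle : ∀ j : J, f j ≤ ⨆ j ∈ J, f j := fun j => le_iSup₂_of_le j.1 j.2 le_rfl
  refine ⟨J, fun j => (f j).map e, ?_, ?_, ?_⟩
  · rw [iSupIndep_iff_finsetSum_eq_zero_imp_eq_zero]
    intro s v hv hsum
    have hindJ : iSupIndep (fun j : J => f j) := hind.comp Subtype.val_injective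
    rw [iSupIndep_iff_finsetSum_eq_zero_imp_eq_zero] at hindJ
    have hch : ∀ j : J, ∃ u : M, j ∈ s → (u ∈ f j ∧ e u = v j) := by
      intro j
      by_cases hj : j ∈ s
      · obtain ⟨u, hu, hue⟩ := hv j hj
        exact ⟨u, fun _ => ⟨hu, hue⟩⟩
      · exact ⟨0, fun h => absurd h hj⟩
    choose u hu using hch
    have hz : ∑ j ∈ s, u j = 0 := by
      apply hinj
      · exact sum_mem fun j hj => hle j (hu j hj).1
      · rw [map_sum, ← hsum]
        exact Finset.sum_congr rfl fun j hj => (hu j hj).2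
    intro j hj
    rw [← (hu j hj).2, hindJ s u (fun j hj => (hu j hj).1) hz j hj, map_zero]
  · rw [← Submodule.map_iSup]
    refine eq_top_iff.2 fun q _ => ?_
    obtain ⟨m, rfl⟩ := hsurj q
    have hm : m ∈ LinearMap.ker e ⊔ ⨆ j ∈ J, f j := by
      rw [hJ.sup_eq_top]; exact Submodule.mem_top
    obtain ⟨a, ha, b, hb, rfl⟩ := Submodule.mem_sup.1 hm
    refine ⟨b, ?_, ?_⟩
    · rwa [iSup_subtype']  at hb
    · rw [map_add, LinearMap.mem_ker.1 ha, zero_add]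
  · exact fun j => simpleHW_map H e heq _ (fun m hm => hinj m (hle j hm)) (hf j)

theorem O1_sub (W : LieSubmodule ℂ L M)
    (hM : ∃ (ι : Type) (f : ι → Submodule ℂ M),
      iSupIndep f ∧ (⨆ i, f i) = ⊤ ∧ ∀ i, IsSimpleHW H Δ θ (f i)) :
    ∃ (ι : Type) (f : ι → Submodule ℂ W),
      iSupIndep f ∧ (⨆ i, f i) = ⊤ ∧ ∀ i, IsSimpleHW H Δ θ (f i) := by
  obtain ⟨ι, f, hind, htop, hf⟩ := id hM
  obtain ⟨J, hJ⟩ := exists_compl H f htop hf W.toSubmodule (fun x _ m hm => W.lie_mem hm)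
  have hst : lStable H θ (⨆ j ∈ J, f j) :=
    lStable_iSup H fun j => lStable_iSup H fun _ => (hf j).2.1
  let e : M →ₗ[ℂ] W := Submodule.projectionOnto W.toSubmodule _ hJ
  have he1 : ∀ w : W, e w = w := fun w => Submodule.projectionOnto_apply_left hJ w
  have he2 : ∀ m ∈ ⨆ j ∈ J, f j, e m = 0 := fun m hm =>
    (Submodule.projectionOnto_apply_eq_zero_iff hJ).2 hm
  refine O1_map H e ?_ (fun w => ⟨w, he1 w⟩) hM
  intro x hx m
  have hm : m ∈ W.toSubmodule ⊔ ⨆ j ∈ J, f j := by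
    rw [hJ.sup_eq_top]; exact Submodule.mem_top
  obtain ⟨a, ha, b, hb, rfl⟩ := Submodule.mem_sup.1 hm
  rw [lie_add, map_add, map_add, he2 b hb, he2 _ (hst x hx b hb), add_zero, add_zero]
  have h1 := he1 ⟨a, ha⟩
  have h2 := he1 ⁅x, (⟨a, ha⟩ : W)⁆
  rw [LieSubmodule.coe_bracket] at h2
  change e a = _ at h1
  change e ⁅x, a⁆ = _ at h2
  rw [h1, h2]

theorem O1_prod
    (hM : ∃ (ι : Type) (f : ι → Submodule ℂ M),
      iSupIndep f ∧ (⨆ i, f i) = ⊤ ∧ ∀ i, IsSimpleHW H Δ θ (f i))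
    (hQ : ∃ (ι : Type) (f : ι → Submodule ℂ Q),
      iSupIndep f ∧ (⨆ i, f i) = ⊤ ∧ ∀ i, IsSimpleHW H Δ θ (f i)) :
    ∃ (ι : Type) (f : ι → Submodule ℂ (M × Q)),
      iSupIndep f ∧ (⨆ i, f i) = ⊤ ∧ ∀ i, IsSimpleHW H Δ θ (f i) := by
  obtain ⟨ι, f, hind, htop, hf⟩ := hM
  obtain ⟨κ, g, hind', htop', hg⟩ := hQ
  refine ⟨ι ⊕ κ, Sum.elim (fun i => (f i).map (LinearMap.inl ℂ M Q))
    (fun i => (g i).map (LinearMap.inr ℂ M Q)), ?_, ?_, ?_⟩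
  · rw [iSupIndep_iff_finsetSum_eq_zero_imp_eq_zero] at hind hind' ⊢
    intro s v hv hsum
    have h1 := congrArg Prod.fst hsum
    have h2 := congrArg Prod.snd hsum
    rw [Prod.fst_sum, ← Finset.toLeft_disjSum_toRight (u := s), Finset.sum_disjSum] at h1
    rw [Prod.snd_sum, ← Finset.toLeft_disjSum_toRight (u := s), Finset.sum_disjSum] at h2
    have hl : ∀ i ∈ s.toLeft, (v (Sum.inl i)).1 ∈ f i ∧ (v (Sum.inl i)).2 = 0 := by
      intro i hi
      obtain ⟨m, hm, h⟩ := hv _ (Finset.mem_toLeft.1 hi)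
      rw [← h]; exact ⟨hm, rfl⟩
    have hr : ∀ i ∈ s.toRight, (v (Sum.inr i)).2 ∈ g i ∧ (v (Sum.inr i)).1 = 0 := by
      intro i hi
      obtain ⟨m, hm, h⟩ := hv _ (Finset.mem_toRight.1 hi)
      rw [← h]; exact ⟨hm, rfl⟩
    rw [Finset.sum_eq_zero (s := s.toRight) (fun i hi => (hr i hi).2), add_zero] at h1
    rw [Finset.sum_eq_zero (s := s.toLeft) (fun i hi => (hl i hi).2), zero_add] at h2
    rintro (i | i) hi
    · have hi' := Finset.mem_toLeft.2 hi
      exact Prod.ext (hind s.toLeft _ (fun i hi => (hl i hi).1) h1 i hi') (hl i hi').2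
    · have hi' := Finset.mem_toRight.2 hi
      exact Prod.ext (hr i hi').2 (hind' s.toRight _ (fun i hi => (hr i hi).1) h2 i hi')
  · rw [iSup_sum]
    simp only [Sum.elim_inl, Sum.elim_inr]
    rw [← Submodule.map_iSup, ← Submodule.map_iSup, htop, htop', Submodule.map_top,
      Submodule.map_top, LinearMap.sup_range_inl_inr]
  · rintro (i | i)
    · exact simpleHW_map H (LinearMap.inl ℂ M Q)
        (fun x _ m => Prod.ext rfl (lie_zero x).symm) _
        (fun m _ h => congrArg Prod.fst h) (hf i)
    · exact simpleHW_map H (LinearMap.inr ℂ M Q)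
        (fun x _ m => Prod.ext (lie_zero x).symm rfl) _
        (fun m _ h => congrArg Prod.snd h) (hg i)
end O1

section Final
variable {L : Type*} [LieRing L] [LieAlgebra ℂ L]
  {M : Type*} [AddCommGroup M] [Module ℂ M] [LieRingModule L M] [LieModule ℂ L M]
  {N : Type*} [AddCommGroup N] [Module ℂ N] [LieRingModule L N] [LieModule ℂ L N]
  (H : LieSubalgebra ℂ L) {Δ S θ : Finset (Module.Dual ℂ H)}

theorem fd_prod {P : Submodule ℂ M} {Q : Submodule ℂ N} (hP : FiniteDimensional ℂ P)
    (hQ : FiniteDimensional ℂ Q) : FiniteDimensional ℂ (P.prod Q) :=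
  Module.Finite.iff_fg.2 ((Module.Finite.iff_fg.1 hP).prod (Module.Finite.iff_fg.1 hQ))

theorem fg_prod (hM : ∃ s : Finset M, LieSubmodule.lieSpan ℂ L (s : Set M) = ⊤)
    (hN : ∃ s : Finset N, LieSubmodule.lieSpan ℂ L (s : Set N) = ⊤) :
    ∃ s : Finset (M × N), LieSubmodule.lieSpan ℂ L (s : Set (M × N)) = ⊤ := by
  obtain ⟨s, hs⟩ := hM
  obtain ⟨t, ht⟩ := hN
  refine ⟨s.image (fun m => (m, 0)) ∪ t.image (fun n => (0, n)), ?_⟩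
  set K := LieSubmodule.lieSpan ℂ L
    ((s.image (fun m => (m, 0)) ∪ t.image (fun n => (0, n)) : Finset (M × N)) : Set (M × N))
  let K1 : LieSubmodule ℂ L M :=
    { K.toSubmodule.comap (LinearMap.inl ℂ M N) with
      lie_mem := by
        intro x m hm
        have h : ⁅x, ((m, 0) : M × N)⁆ ∈ K := K.lie_mem hm
        have e : ⁅x, ((m, 0) : M × N)⁆ = (⁅x, m⁆, 0) := Prod.ext rfl (lie_zero x)
        rw [e] at h
        exact h }
  let K2 : LieSubmodule ℂ L N :=
    { K.toSubmodule.comap (LinearMap.inr ℂ M N) with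
      lie_mem := by
        intro x m hm
        have h : ⁅x, ((0, m) : M × N)⁆ ∈ K := K.lie_mem hm
        have e : ⁅x, ((0, m) : M × N)⁆ = (0, ⁅x, m⁆) := Prod.ext (lie_zero x) rfl
        rw [e] at h
        exact h }
  have h1 : LieSubmodule.lieSpan ℂ L (s : Set M) ≤ K1 := LieSubmodule.lieSpan_le.2 (by
    intro m hm
    change (m, (0 : N)) ∈ K
    apply LieSubmodule.subset_lieSpan
    simp only [Finset.coe_union, Finset.coe_image]
    exact Or.inl ⟨m, hm, rfl⟩)
  have h2 : LieSubmodule.lieSpan ℂ L (t : Set N) ≤ K2 := LieSubmodule.lieSpan_le.2 (by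
    intro m hm
    change ((0 : M), m) ∈ K
    apply LieSubmodule.subset_lieSpan
    simp only [Finset.coe_union, Finset.coe_image]
    exact Or.inr ⟨m, hm, rfl⟩)
  rw [hs] at h1
  rw [ht] at h2
  refine eq_top_iff.2 ?_
  rintro ⟨m, n⟩ -
  have h3 : (m, (0 : N)) ∈ K := h1 (LieSubmodule.mem_top m)
  have h4 : ((0 : M), n) ∈ K := h2 (LieSubmodule.mem_top n)
  have := K.add_mem h3 h4
  simpa using this

theorem inO_prod (hM : InO H Δ S θ M) (hN : InO H Δ S θ N) : InO H Δ S θ (M × N) := by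
  obtain ⟨⟨hM1, hM2, hM3⟩, hM4, hM5, hM6⟩ := hM
  obtain ⟨⟨hN1, hN2, hN3⟩, hN4, hN5, hN6⟩ := hN
  refine ⟨⟨fg_prod hM1 hN1, ?_, ?_⟩, O1_prod H hM4 hN4, ?_, ?_⟩
  · refine top_le_iff.1 ?_
    rw [← LinearMap.sup_range_inl_inr, ← Submodule.map_top, ← Submodule.map_top, ← hM2, ← hN2,
      Submodule.map_iSup, Submodule.map_iSup]
    refine sup_le (iSup_mono fun α => ?_) (iSup_mono fun α => ?_)
    · rintro _ ⟨m, hm, rfl⟩ h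
      exact Prod.ext (hm h) ((lie_zero _).trans (smul_zero _).symm)
    · rintro _ ⟨m, hm, rfl⟩ h
      exact Prod.ext ((lie_zero _).trans (smul_zero _).symm) (hm h)
  · intro α
    have := fd_prod (hM3 α) (hN3 α)
    refine Submodule.finiteDimensional_of_le
      (S₂ := (wSpace H (M := M) α).prod (wSpace H (M := N) α)) ?_
    intro p hp
    exact ⟨fun h => congrArg Prod.fst (hp h), fun h => congrArg Prod.snd (hp h)⟩
  · intro α hα x hx hx0 p q hpq
    exact Prod.ext (hM5 α hα x hx hx0 (congrArg Prod.fst hpq))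
      (hN5 α hα x hx hx0 (congrArg Prod.snd hpq))
  · rintro ⟨m, n⟩
    obtain ⟨P, hmP, hP, hPs⟩ := hM6 m
    obtain ⟨Q, hnQ, hQ, hQs⟩ := hN6 n
    exact ⟨P.prod Q, ⟨hmP, hnQ⟩, fd_prod hP hQ,
      fun x hx w hw => ⟨hPs x hx _ hw.1, hQs x hx _ hw.2⟩⟩

theorem inO_sub [FiniteDimensional ℂ L] (hM : InO H Δ S θ M) (W : LieSubmodule ℂ L M) :
    InO H Δ S θ W := by
  obtain ⟨⟨hM1, hM2, hM3⟩, hM4, hM5, hM6⟩ := hM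
  have hfd : ∀ P : Submodule ℂ M, FiniteDimensional ℂ P →
      FiniteDimensional ℂ (P.comap W.toSubmodule.subtype) := fun P hP =>
    FiniteDimensional.of_injective
      (W.toSubmodule.subtype.restrict (p := P.comap W.toSubmodule.subtype) (q := P)
        (fun _ h => h))
      (fun a b hab => Subtype.ext (Subtype.ext (congrArg (fun z : P => (z : M)) hab)))
  refine ⟨⟨fg_sub hM1 W, ?_, ?_⟩, O1_sub H W hM4, ?_, ?_⟩
  · refine eq_top_iff.2 ?_
    rintro ⟨m, hm⟩ -
    obtain ⟨s, u, hu, rfl⟩ := wt_decomp H hM2 m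
    have hsep := wt_sep H W id Function.injective_id s u (fun i _ => hu i) hm
    have e : (⟨∑ α ∈ s, u α, hm⟩ : W) = ∑ α ∈ s.attach, ⟨u α.1, hsep α.1 α.2⟩ := by
      apply Subtype.ext
      change _ = W.toSubmodule.subtype (∑ α ∈ s.attach, ⟨u α.1, hsep α.1 α.2⟩)
      rw [map_sum]
      exact (Finset.sum_attach s u).symm
    rw [e]
    exact sum_mem fun α _ => Submodule.mem_iSup_of_mem α.1 fun h => Subtype.ext (hu α.1 h)
  · intro α
    have := hfd _ (hM3 α)
    refine Submodule.finiteDimensional_of_le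
      (S₂ := (wSpace H (M := M) α).comap W.toSubmodule.subtype) ?_
    intro p hp h
    exact congrArg Subtype.val (hp h)
  · intro α hα x hx hx0 p q hpq
    exact Subtype.ext (hM5 α hα x hx hx0 (congrArg Subtype.val hpq))
  · rintro ⟨m, hm⟩
    obtain ⟨P, hmP, hP, hPs⟩ := hM6 m
    exact ⟨P.comap W.toSubmodule.subtype, hmP, hfd P hP, fun x hx w hw => hPs x hx _ hw⟩

theorem inO_quot [FiniteDimensional ℂ L] [LieAlgebra.IsSimple ℂ L] [H.IsCartanSubalgebra]
    (hM : InO H Δ S θ M) (W : LieSubmodule ℂ L M) : InO H Δ S θ (M ⧸ W) := by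
  obtain ⟨⟨hM1, hM2, hM3⟩, hM4, hM5, hM6⟩ := hM
  let e : M →ₗ[ℂ] M ⧸ W := (LieSubmodule.Quotient.mk' W : M →ₗ[ℂ] M ⧸ W)
  have hsurj : Function.Surjective e := LieSubmodule.Quotient.surjective_mk' W
  have heq : ∀ (x : L) (m : M), e ⁅x, m⁆ = ⁅x, e m⁆ := fun x m => rfl
  have hker : ∀ m, e m = 0 ↔ m ∈ W := fun m => LieSubmodule.Quotient.mk_eq_zero W
  refine ⟨⟨?_, ?_, ?_⟩, O1_map H e (fun x _ m => heq x m) hsurj hM4, ?_, ?_⟩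
  · obtain ⟨s, hs⟩ := hM1
    refine ⟨s.image e, ?_⟩
    set K := LieSubmodule.lieSpan ℂ L ((s.image e : Finset (M ⧸ W)) : Set (M ⧸ W))
    have h1 : LieSubmodule.lieSpan ℂ L (s : Set M) ≤ K.comap (LieSubmodule.Quotient.mk' W) :=
      LieSubmodule.lieSpan_le.2 (by
        intro m hm
        change e m ∈ K
        apply LieSubmodule.subset_lieSpan
        rw [Finset.coe_image]
        exact ⟨m, hm, rfl⟩)
    rw [hs] at h1
    refine eq_top_iff.2 fun q _ => ?_
    obtain ⟨m, rfl⟩ := hsurj q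
    exact h1 (LieSubmodule.mem_top m)
  · refine top_le_iff.1 ?_
    rw [← LinearMap.range_eq_top.2 hsurj, ← Submodule.map_top, ← hM2, Submodule.map_iSup]
    refine iSup_mono fun α => ?_
    rintro _ ⟨m, hm, rfl⟩ h
    rw [← heq, hm h, map_smul]
  · intro α
    have := hM3 α
    have : FiniteDimensional ℂ ((wSpace H (M := M) α).map e) := inferInstance
    refine Submodule.finiteDimensional_of_le (S₂ := (wSpace H (M := M) α).map e) ?_
    intro q hq
    obtain ⟨m, rfl⟩ := hsurj q
    obtain ⟨s, u, hu, rfl⟩ := wt_decomp H hM2 m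
    have hW : ∀ β ∈ s, β ≠ α → u β ∈ W := by
      intro β hβ hne
      obtain ⟨h, hh⟩ : ∃ h, β h ≠ α h := by
        by_contra hc; push Not at hc; exact hne (LinearMap.ext hc)
      have h1 : ∑ γ ∈ s, (γ h - α h) • u γ ∈ W := by
        rw [← hker]
        have h2 := hq h
        rw [← heq, ← map_smul, ← sub_eq_zero, ← map_sub] at h2
        rw [← h2]
        congr 1
        rw [lie_sum, Finset.smul_sum, ← Finset.sum_sub_distrib]
        refine Finset.sum_congr rfl fun γ _ => ?_
        rw [hu γ h, sub_smul]
      have h2 := wt_sep H W id Function.injective_id s (fun γ => (γ h - α h) • u γ)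
        (fun γ _ => Submodule.smul_mem _ _ (hu γ)) h1 β hβ
      have h3 := W.smul_mem (β h - α h)⁻¹ h2
      rwa [smul_smul, inv_mul_cancel₀ (sub_ne_zero.2 hh), one_smul] at h3
    rw [map_sum]
    refine sum_mem fun β hβ => ?_
    by_cases hβα : β = α
    · exact ⟨u β, hβα ▸ hu β, rfl⟩
    · rw [(hker _).2 (hW β hβ hβα)]; exact Submodule.zero_mem _
  · intro α hα x hx hx0
    have hα' := neg_inSpan H hα
    obtain ⟨y, hy, hy0⟩ := neg_root H hα.1.2
    have hxi := hM5 α hα x hx hx0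
    have hyi := hM5 _ hα' y hy hy0
    refine (injective_iff_map_eq_zero _).2 fun q hq => ?_
    obtain ⟨m, rfl⟩ := hsurj q
    obtain ⟨s, u, hu, rfl⟩ := wt_decomp H hM2 m
    have h1 : ∑ β ∈ s, ⁅x, u β⁆ ∈ W := by
      rw [← lie_sum, ← hker]
      exact hq
    have h2 := wt_sep H W (fun β => β + α) (add_left_injective α) s (fun β => ⁅x, u β⁆)
      (fun β _ => lie_mem_wSpace H hx (hu β)) h1
    rw [map_sum]
    refine Finset.sum_eq_zero fun β hβ => ?_
    obtain ⟨v, hv, hvx⟩ := wt_surj H W hM3 hx hy hxi hyi β _ (h2 β hβ)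
      (lie_mem_wSpace H hx (hu β))
    have : v = u β := hxi hvx
    rw [hker, ← this]
    exact hv
  · intro q
    obtain ⟨m, rfl⟩ := hsurj q
    obtain ⟨P, hmP, hP, hPs⟩ := hM6 m
    refine ⟨P.map e, ⟨m, hmP, rfl⟩, inferInstance, ?_⟩
    rintro x hx _ ⟨w, hw, rfl⟩
    exact ⟨⁅x, w⁆, hPs x hx w hw, heq x w⟩
end Final

/-- The category `O_{S,θ}` is closed under finite direct sums,
submodules, and quotients. -/
theorem inO_closed_under_sum_sub_quot
    {L : Type*} [LieRing L] [LieAlgebra ℂ L] [FiniteDimensional ℂ L]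
    [LieAlgebra.IsSimple ℂ L]
    (H : LieSubalgebra ℂ L) [H.IsCartanSubalgebra]
    (Δ : Finset (Module.Dual ℂ H)) (hΔ : IsBase H Δ)
    (S θ : Finset (Module.Dual ℂ H)) (hθS : θ ⊆ S) (hS : S ⊆ Δ)
    (M : Type*) [AddCommGroup M] [Module ℂ M] [LieRingModule L M] [LieModule ℂ L M]
    (N : Type*) [AddCommGroup N] [Module ℂ N] [LieRingModule L N] [LieModule ℂ L N]
    (hM : InO H Δ S θ M) (hN : InO H Δ S θ N) :
    InO H Δ S θ (M × N) ∧
    (∀ W : LieSubmodule ℂ L M, InO H Δ S θ W) ∧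
    (∀ W : LieSubmodule ℂ L M, InO H Δ S θ (M ⧸ W)) := by
  exact ⟨inO_prod H hM hN, fun W => inO_sub H hM W, fun W => inO_quot H hM W⟩

end Paper
end
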